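/- arXiv:1206.3347 — 10 statements merged into one kernel-verified Lean document; each statement's English description precedes it below -/
import Mathlib

section
/- Fix a positive infinitesimal hyperreal δ, a directed nonempty preorder (D, ≤), a family of functions f_d : ℝⁿ → ℝ (d ∈ D) each of which is continuous on some neighborhood of 0, and a function g : ℝⁿ → ℝ. Assume that for every m ∈ SM there is d₀ ∈ D such that for all d ≥ d₀ and all ξ ∈ *ℝⁿ with ‖ξ‖ ≤ δ one has |(*f_d)(ξ) − (*g)(ξ)| < (*m)(δ). Then there exists a real r > 0 such that g is continuous on the closed ball of radius r about 0. (A net of germs of continuous functions converging in the germ topology τ_δ has a continuous germ as its limit.) -/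
open Filter Topology

noncomputable section

/-- Nonstandard extension of a type, via the hyperfilter ultrapower. -/
abbrev NS (E : Type*) : Type _ := Filter.Germ (Filter.hyperfilter ℕ : Filter ℕ) E

/-- Euclidean `n`-space. -/
abbrev Euc (n : ℕ) : Type := EuclideanSpace ℝ (Fin n)

/-- The hyperreal norm of a nonstandard point. -/
def germNorm {E : Type*} [NormedAddCommGroup E] (ξ : NS E) : Hyperreal :=
  ξ.map norm

/-- The star of a standard real-valued function, applied at a nonstandard point. -/
def starApp {E : Type*} (f : E → ℝ) (ξ : NS E) : Hyperreal := ξ.map f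

/-- The star of a standard map between spaces. -/
def starMap {E F : Type*} (f : E → F) (ξ : NS E) : NS F := ξ.map f

/-- The star of a standard point. -/
def starPt {E : Type*} (x : E) : NS E := ↑(fun _ : ℕ => x)

/-- Value of the star of a standard function `m : ℝ → ℝ` at a hyperreal. -/
def starFun (m : ℝ → ℝ) (δ : Hyperreal) : Hyperreal := Filter.Germ.map m δ

/-- `m` is a modulus on the interval `(0, a)`: strictly increasing, strictly positive,
with limit `0` at `0⁺`. -/
def SMOn (m : ℝ → ℝ) (a : ℝ) : Prop :=
  0 < a ∧ StrictMonoOn m (Set.Ioo 0 a) ∧ (∀ t ∈ Set.Ioo 0 a, 0 < m t) ∧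
    Filter.Tendsto m (𝓝[>] (0:ℝ)) (𝓝 0)

/-- The class `SM` of moduli. -/
def SM : Set (ℝ → ℝ) := {m | ∃ a, SMOn m a}

/-- The set `SN_δ` of moduli values at `δ`. -/
def SN (δ : Hyperreal) : Set Hyperreal := {x | ∃ m ∈ SM, starFun m δ = x}

end

/-- The numbers `ε ∈ [0, 1]` such that, at some point of `s`, the oscillation of `g` within `s`
is at least `ε`. -/
def jumpsWithin {X : Type*} [PseudoMetricSpace X] (g : X → ℝ) (s : Set X) : Set ℝ :=
  {ε | 0 ≤ ε ∧ ε ≤ 1 ∧ ∃ x ∈ s, ∀ η > 0, ∃ y ∈ s, dist y x < η ∧ ε ≤ |g y - g x|}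

/-- The largest jump of `g` within `s`, capped at `1`. -/
noncomputable def maxJumpWithin {X : Type*} [PseudoMetricSpace X] (g : X → ℝ) (s : Set X) : ℝ :=
  sSup (jumpsWithin g s)

section Jumps

variable {X : Type*} [PseudoMetricSpace X] {f g : X → ℝ} {s t : Set X}

lemma jumpsWithin_mono (h : s ⊆ t) : jumpsWithin g s ⊆ jumpsWithin g t := by
  rintro ε ⟨h0, h1, x, hx, H⟩
  refine ⟨h0, h1, x, h hx, fun η hη => ?_⟩
  obtain ⟨y, hy, hyx⟩ := H η hη
  exact ⟨y, h hy, hyx⟩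

lemma zero_mem_jumpsWithin (h : s.Nonempty) : 0 ∈ jumpsWithin g s := by
  obtain ⟨x, hx⟩ := h
  exact ⟨le_rfl, zero_le_one, x, hx, fun η hη => ⟨x, hx, by simpa using hη, abs_nonneg _⟩⟩

lemma bddAbove_jumpsWithin (g : X → ℝ) (s : Set X) : BddAbove (jumpsWithin g s) :=
  ⟨1, fun _ h => h.2.1⟩

lemma maxJumpWithin_le_one (g : X → ℝ) (s : Set X) : maxJumpWithin g s ≤ 1 :=
  Real.sSup_le (fun _ h => h.2.1) zero_le_one

lemma maxJumpWithin_mono (hs : s.Nonempty) (h : s ⊆ t) :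
    maxJumpWithin g s ≤ maxJumpWithin g t :=
  csSup_le_csSup (bddAbove_jumpsWithin g t) ⟨0, zero_mem_jumpsWithin hs⟩ (jumpsWithin_mono h)

lemma maxJumpWithin_pos (h : ¬ ContinuousOn g s) : 0 < maxJumpWithin g s := by
  rw [Metric.continuousOn_iff] at h
  push Not at h
  obtain ⟨x, hx, ε, hε, H⟩ := h
  refine lt_of_lt_of_le (lt_min hε one_pos) (le_csSup (bddAbove_jumpsWithin g s)
    ⟨(lt_min hε one_pos).le, min_le_right _ _, x, hx, fun η hη => ?_⟩)
  obtain ⟨y, hy, hyx, hd⟩ := H η hη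
  exact ⟨y, hy, hyx, (min_le_left _ _).trans (by rwa [Real.dist_eq] at hd)⟩

/-- A function uniformly `M`-close on `s` to a continuous one has jumps of size at most `2 * M`. -/
lemma maxJumpWithin_le_two_mul (hs : s.Nonempty) (hf : ContinuousOn f s) {M : ℝ}
    (h : ∀ x ∈ s, |f x - g x| < M) : maxJumpWithin g s ≤ 2 * M := by
  refine csSup_le ⟨0, zero_mem_jumpsWithin hs⟩ ?_
  rintro ε ⟨-, -, x, hx, H⟩
  refine le_of_forall_pos_le_add fun e he => ?_
  obtain ⟨η, hη, hc⟩ := Metric.continuousOn_iff.1 hf x hx e he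
  obtain ⟨y, hy, hyx, hε⟩ := H η hη
  have h1 := hc y hy hyx
  rw [Real.dist_eq] at h1
  have h2 := abs_lt.1 h1
  have h3 := abs_lt.1 (h x hx)
  have h4 := abs_lt.1 (h y hy)
  refine hε.trans (abs_le.2 ⟨?_, ?_⟩) <;> linarith

end Jumps

/-- If `g` is discontinuous on every ball about `x`, then `r ↦ r * maxJumpWithin g (closedBall x r)`
is a modulus. -/
lemma mul_maxJumpWithin_closedBall_mem_SM {X : Type*} [PseudoMetricSpace X] {g : X → ℝ} {x : X}
    (h : ∀ r : ℝ, 0 < r → ¬ ContinuousOn g (Metric.closedBall x r)) :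
    (fun r => r * maxJumpWithin g (Metric.closedBall x r)) ∈ SM := by
  have hpos : ∀ r : ℝ, 0 < r → 0 < maxJumpWithin g (Metric.closedBall x r) :=
    fun r hr => maxJumpWithin_pos (h r hr)
  refine ⟨1, one_pos, ?_, fun t ht => mul_pos ht.1 (hpos t ht.1), ?_⟩
  · intro a ha b hb hab
    exact mul_lt_mul hab (maxJumpWithin_mono (Metric.nonempty_closedBall.2 ha.1.le)
      (Metric.closedBall_subset_closedBall hab.le)) (hpos a ha.1) hb.1.le
  · refine squeeze_zero' (g := fun t : ℝ => t) ?_ ?_ (tendsto_id.mono_left nhdsWithin_le_nhds)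
    · filter_upwards [self_mem_nhdsWithin] with t ht using (mul_pos ht (hpos t ht)).le
    · filter_upwards [self_mem_nhdsWithin] with t ht
      exact mul_le_of_le_one_right (le_of_lt ht) (maxJumpWithin_le_one _ _)

/-- A strict bound on all nonstandard points of an infinitesimal ball holds on almost all of the
standard balls representing it. -/
lemma eventually_forall_abs_sub_lt {E : Type*} [NormedAddCommGroup E] {f g : E → ℝ} {m : ℝ → ℝ}
    {u : ℕ → ℝ}
    (h : ∀ ξ : NS E, germNorm ξ ≤ Hyperreal.ofSeq u →
      |starApp f ξ - starApp g ξ| < starFun m (Hyperreal.ofSeq u)) :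
    ∀ᶠ k in (hyperfilter ℕ : Filter ℕ), ∀ x : E, ‖x‖ ≤ u k → |f x - g x| < m (u k) := by
  by_contra hcon
  rw [← Ultrafilter.eventually_not] at hcon
  have hex : ∀ k, ∃ x : E, (¬ ∀ x : E, ‖x‖ ≤ u k → |f x - g x| < m (u k)) →
      ‖x‖ ≤ u k ∧ m (u k) ≤ |f x - g x| := by
    intro k
    by_cases hk : ∀ x : E, ‖x‖ ≤ u k → |f x - g x| < m (u k)
    · exact ⟨0, fun h' => absurd hk h'⟩
    · push Not at hk
      exact hk.imp fun x hx _ => hx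
  choose x hx using hex
  have hle : Hyperreal.ofSeq (fun k => ‖x k‖) ≤ Hyperreal.ofSeq u :=
    Hyperreal.ofSeq_le_ofSeq.2 (hcon.mono fun k hk => (hx k hk).1)
  have hlt := abs_lt.1 (h ((x : ℕ → E) : NS E) hle)
  have h1 : ∀ᶠ k in (hyperfilter ℕ : Filter ℕ), -m (u k) < f (x k) - g (x k) :=
    Hyperreal.ofSeq_lt_ofSeq.1 hlt.1
  have h2 : ∀ᶠ k in (hyperfilter ℕ : Filter ℕ), f (x k) - g (x k) < m (u k) :=
    Hyperreal.ofSeq_lt_ofSeq.1 hlt.2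
  obtain ⟨k, hk, hk1, hk2⟩ := (hcon.and (h1.and h2)).exists
  exact absurd (abs_lt.2 ⟨hk1, hk2⟩) (hx k hk).2.not_gt

/-- A net of germs of continuous functions that converges in the germ
topology `τ_δ` to `g` forces `g` to be continuous on a standard ball about `0`. -/
theorem stmt3 {n : ℕ} (δ : Hyperreal) (hδpos : 0 < δ) (hδinf : δ.Infinitesimal)
    {D : Type*} [Preorder D] [IsDirected D (· ≤ ·)] [Nonempty D]
    (f : D → Euc n → ℝ)
    (hf : ∀ d : D, ∃ U ∈ 𝓝 (0 : Euc n), ContinuousOn (f d) U)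
    (g : Euc n → ℝ)
    (hconv : ∀ m ∈ SM, ∃ d₀ : D, ∀ d : D, d₀ ≤ d →
      ∀ ξ : NS (Euc n), germNorm ξ ≤ δ →
        |starApp (f d) ξ - starApp g ξ| < starFun m δ) :
    ∃ r : ℝ, 0 < r ∧ ContinuousOn g (Metric.closedBall (0 : Euc n) r) := by
  by_contra! hcon
  obtain ⟨d, hd⟩ := hconv _ (mul_maxJumpWithin_closedBall_mem_SM hcon)
  obtain ⟨U, hU, hfU⟩ := hf d
  obtain ⟨ρ, hρ, hρU⟩ := Metric.nhds_basis_closedBall.mem_iff.1 hU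
  obtain ⟨u, rfl⟩ := Hyperreal.ofSeq_surjective δ
  have hpos : ∀ᶠ k in (hyperfilter ℕ : Filter ℕ), 0 < u k := Hyperreal.ofSeq_lt_ofSeq.1 hδpos
  have hlt : ∀ r : ℝ, 0 < r → ∀ᶠ k in (hyperfilter ℕ : Filter ℕ), u k < r := fun r hr =>
    Hyperreal.ofSeq_lt_ofSeq.1 (hδinf r hr).2 |>.mono fun k hk => by simpa using hk
  obtain ⟨k, hk0, hkρ, hk2, hk⟩ := (hpos.and ((hlt ρ hρ).and
    ((hlt (1 / 2) (by norm_num)).and (eventually_forall_abs_sub_lt (hd d le_rfl))))).exists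
  have hjump := maxJumpWithin_le_two_mul (Metric.nonempty_closedBall.2 hk0.le)
    (hfU.mono ((Metric.closedBall_subset_closedBall hkρ.le).trans hρU))
    fun x hx => hk x (mem_closedBall_zero_iff.1 hx)
  nlinarith [maxJumpWithin_pos (hcon _ hk0)]
end

section
/- Let δ be a positive infinitesimal hyperreal and let (m_j)_{j∈ℕ} be a sequence of elements of SM. Then there exists h ∈ SM such that 0 < (*h)(δ) < (*m_j)(δ) for every j ∈ ℕ. Consequently, the set SN_δ = {(*m)(δ) : m ∈ SM} of moduli contains no countable coinitial subset (a subset S ⊆ SN_δ is coinitial if for every element of SN_δ some member of S is ≤ it). -/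
open Filter Topology

/-- A pointwise strict inequality near `0⁺` transfers to every positive infinitesimal. -/
theorem starFun_lt_starFun {δ : Hyperreal} (hδpos : 0 < δ)
    (hδ : ∀ c : ℝ, 0 < c → δ < (c : Hyperreal)) {f g : ℝ → ℝ}
    (hfg : ∀ᶠ t in 𝓝[>] (0 : ℝ), f t < g t) : starFun f δ < starFun g δ := by
  obtain ⟨d, rfl⟩ := Hyperreal.ofSeq_surjective δ
  obtain ⟨c, hc, hsub⟩ := mem_nhdsGT_iff_exists_Ioo_subset.1 hfg
  have hpos : ∀ᶠ n in hyperfilter ℕ, 0 < d n := Hyperreal.ofSeq_lt_ofSeq.1 hδpos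
  have hlt : ∀ᶠ n in hyperfilter ℕ, d n < c := Hyperreal.ofSeq_lt_ofSeq.1 (hδ c hc)
  change Hyperreal.ofSeq (f ∘ d) < Hyperreal.ofSeq (g ∘ d)
  rw [Hyperreal.ofSeq_lt_ofSeq]
  filter_upwards [hpos, hlt] with n h₁ h₂ using hsub ⟨h₁, h₂⟩

/-- Any sequence of moduli has a modulus eventually strictly below each of its members. -/
theorem exists_mem_SM_eventually_lt {m : ℕ → ℝ → ℝ} (hm : ∀ j, m j ∈ SM) :
    ∃ h ∈ SM, (∀ t, 0 < t → 0 < h t) ∧ ∀ j, ∀ᶠ t in 𝓝[>] (0 : ℝ), h t < m j t := by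
  choose a ha hmono hpos _ using hm
  let b : ℕ → ℝ := fun j => min (a j) (1 / ((j : ℝ) + 1))
  have hb : ∀ j, 0 < b j := fun j => lt_min (ha j) (by positivity)
  let g : ℕ → ℝ → ℝ := fun j t => if t < b j then min (m j t) 1 else 1
  have g_pos : ∀ j t, 0 < t → 0 < g j t := by
    intro j t ht
    by_cases h : t < b j
    · simpa [g, h] using hpos j t ⟨ht, h.trans_le (min_le_left _ _)⟩
    · simp [g, h]
  have g_le : ∀ j t, g j t ≤ 1 := by
    intro j t
    by_cases h : t < b j <;> simp [g, h]
  have g_mono : ∀ j s t, 0 < s → s ≤ t → g j s ≤ g j t := by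
    intro j s t hs hst
    by_cases h : t < b j
    · have hs' := hst.trans_lt h
      have hms := (hmono j).monotoneOn ⟨hs, hs'.trans_le (min_le_left _ _)⟩
        ⟨hs.trans_le hst, h.trans_le (min_le_left _ _)⟩ hst
      simpa only [g, h, hs', if_true] using min_le_min_right 1 hms
    · simpa only [g, h, if_false] using g_le j s
  let G : ℝ → ℝ := fun t => ⨅ j, g j t
  have bdd : ∀ t, 0 < t → BddBelow (Set.range fun j => g j t) := fun t ht =>
    ⟨0, by rintro _ ⟨j, rfl⟩; exact (g_pos j t ht).le⟩
  have G_le : ∀ j t, 0 < t → G t ≤ g j t := fun j t ht => ciInf_le (bdd t ht) j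
  have G_pos : ∀ t, 0 < t → 0 < G t := by
    intro t ht
    obtain ⟨N, hN⟩ := exists_nat_one_div_lt ht
    have hfin : (Set.range fun j => g j t).Finite := by
      refine (((Set.finite_Iio N).image fun j => g j t).insert 1).subset ?_
      rintro _ ⟨j, rfl⟩
      rcases lt_or_ge j N with hj | hj
      · exact Or.inr ⟨j, hj, rfl⟩
      · left
        have h : ¬ t < b j := not_lt.2 <|
          (min_le_right _ _).trans ((Nat.one_div_le_one_div hj).trans hN.le)
        simp [g, h]
    obtain ⟨j, hj⟩ := (Set.range_nonempty fun j => g j t).csInf_mem hfin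
    exact (g_pos j t ht).trans_eq hj
  have G_mono : ∀ s t, 0 < s → s ≤ t → G s ≤ G t := fun s t hs hst =>
    ciInf_mono (bdd s hs) fun j => g_mono j s t hs hst
  have h_pos : ∀ t, 0 < t → 0 < t * G t := fun t ht => mul_pos ht (G_pos t ht)
  refine ⟨fun t => t * G t, ⟨1, one_pos, ?_, fun t ht => h_pos t ht.1, ?_⟩, h_pos, ?_⟩
  · intro s hs t ht hst
    exact mul_lt_mul hst (G_mono s t hs.1 hst.le) (G_pos s hs.1) ht.1.le
  · refine tendsto_of_tendsto_of_tendsto_of_le_of_le' tendsto_const_nhds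
      (tendsto_id.mono_left nhdsWithin_le_nhds) ?_ ?_
    · filter_upwards [self_mem_nhdsWithin] with t ht using (h_pos t ht).le
    · filter_upwards [self_mem_nhdsWithin] with t ht
      exact mul_le_of_le_one_right (le_of_lt ht) ((G_le 0 t ht).trans (g_le 0 t))
  · intro j
    filter_upwards [Ioo_mem_nhdsGT (lt_min (hb j) one_pos)] with t ht
    have htb : t < b j := ht.2.trans_le (min_le_left _ _)
    calc t * G t < G t := mul_lt_of_lt_one_left (G_pos t ht.1) (ht.2.trans_le (min_le_right _ _))
      _ ≤ g j t := G_le j t ht.1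
      _ ≤ m j t := by simp [g, htb]

/-- Below any countable family of moduli values at a positive infinitesimal there is another. -/
theorem exists_starFun_lt {δ : Hyperreal} (hδpos : 0 < δ) (hδinf : δ.Infinitesimal)
    {m : ℕ → ℝ → ℝ} (hm : ∀ j, m j ∈ SM) :
    ∃ h ∈ SM, 0 < starFun h δ ∧ ∀ j : ℕ, starFun h δ < starFun (m j) δ := by
  have hδ : ∀ c : ℝ, 0 < c → δ < (c : Hyperreal) := fun c hc => by
    simpa using (hδinf c hc).2
  obtain ⟨h, hh, hpos, hlt⟩ := exists_mem_SM_eventually_lt hm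
  refine ⟨h, hh, ?_, fun j => starFun_lt_starFun hδpos hδ (hlt j)⟩
  have h0 : starFun (fun _ => 0) δ = 0 := by
    obtain ⟨d, rfl⟩ := Hyperreal.ofSeq_surjective δ
    rfl
  rw [← h0]
  exact starFun_lt_starFun hδpos hδ (by filter_upwards [self_mem_nhdsWithin] using hpos)

/-- Below any countable family of moduli values at `δ` there is another
modulus value; consequently `SN_δ` has no countable coinitial subset. -/
theorem stmt4 (δ : Hyperreal) (hδpos : 0 < δ) (hδinf : δ.Infinitesimal)
    (m : ℕ → ℝ → ℝ) (hm : ∀ j, m j ∈ SM) :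
    (∃ h ∈ SM, 0 < starFun h δ ∧ ∀ j : ℕ, starFun h δ < starFun (m j) δ) ∧
    (∀ S : Set Hyperreal, S ⊆ SN δ → S.Countable →
      ¬ (∀ x ∈ SN δ, ∃ s ∈ S, s ≤ x)) := by
  refine ⟨exists_starFun_lt hδpos hδinf hm, fun S hS hcount hcoin => ?_⟩
  obtain ⟨s₀, hs₀, -⟩ := hcoin _ ⟨m 0, hm 0, rfl⟩
  obtain ⟨s, rfl⟩ := hcount.exists_eq_range ⟨s₀, hs₀⟩
  choose k hk hks using fun j => hS (Set.mem_range_self j)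
  obtain ⟨h, hh, -, hlt⟩ := exists_starFun_lt hδpos hδinf hk
  obtain ⟨_, ⟨j, rfl⟩, hle⟩ := hcoin _ ⟨h, hh, rfl⟩
  exact absurd (hlt j) (not_lt.2 ((hks j).trans_le hle))
end

section
/- Let δ be a positive infinitesimal hyperreal, (f_i)_{i∈ℕ} a sequence of functions ℝⁿ → ℝ, and g : ℝⁿ → ℝ. Assume that for every m ∈ SM there is i₀ ∈ ℕ such that for all i ≥ i₀ and all ξ ∈ *ℝⁿ with ‖ξ‖ ≤ δ one has |(*f_i)(ξ) − (*g)(ξ)| < (*m)(δ). Then the sequence is eventually germ-constant: there exists i₀ such that for every i ≥ i₀ the function f_i agrees with g on some neighborhood of 0 in ℝⁿ. (Countable sequences of germs converge in the germ topology τ_δ only if they are eventually constant.) -/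
open Filter Topology

/-- A doubly indexed family of positive reals has an antitone positive diagonal lower bound. -/
theorem exists_antitone_pos_diagonal_le (v : ℕ → ℕ → ℝ) (hv : ∀ i k, 0 < v i k) :
    ∃ c : ℕ → ℝ, Antitone c ∧ (∀ N, 0 < c N) ∧ (∀ N, c N ≤ 1) ∧ ∀ i N, i ≤ N → c N ≤ v i N := by
  have hne (N : ℕ) : (Finset.range (N + 1) ×ˢ Finset.range (N + 1)).Nonempty :=
    ⟨(0, 0), by simp⟩
  refine ⟨fun N => (Finset.range (N + 1) ×ˢ Finset.range (N + 1)).inf' (hne N)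
    fun p => min 1 (v p.1 p.2), ?_, ?_, ?_, ?_⟩
  · intro M N h
    refine Finset.inf'_mono _ (Finset.product_subset_product ?_ ?_) (hne M) <;>
      exact Finset.range_mono (by omega)
  · intro N
    rw [Finset.lt_inf'_iff]
    exact fun p _ => lt_min one_pos (hv _ _)
  · intro N
    exact (Finset.inf'_le (fun p : ℕ × ℕ => min 1 (v p.1 p.2))
      (b := (0, 0)) (by simp)).trans (min_le_left _ _)
  · intro i N h
    exact (Finset.inf'_le (fun p : ℕ × ℕ => min 1 (v p.1 p.2))
      (b := (i, N)) (by simp; omega)).trans (min_le_right _ _)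

/-- The product of `t` with an antitone positive sequence evaluated at `⌈1 / t⌉` is a modulus. -/
theorem mul_comp_ceil_inv_mem_SM {c : ℕ → ℝ} (hc : Antitone c) (hpos : ∀ N, 0 < c N)
    (hle : ∀ N, c N ≤ 1) : (fun t : ℝ => t * c ⌈t⁻¹⌉₊) ∈ SM := by
  refine ⟨1, one_pos, ?_, fun t ht => mul_pos ht.1 (hpos _), ?_⟩
  · intro s hs t ht hst
    have h : c ⌈s⁻¹⌉₊ ≤ c ⌈t⁻¹⌉₊ := hc (Nat.ceil_mono (inv_anti₀ hs.1 hst.le))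
    exact mul_lt_mul hst h (hpos _) ht.1.le
  · have hid : Tendsto (fun t : ℝ => t) (𝓝[>] 0) (𝓝 0) := nhdsWithin_le_nhds
    refine tendsto_of_tendsto_of_tendsto_of_le_of_le' tendsto_const_nhds hid ?_ ?_
    · filter_upwards [self_mem_nhdsWithin] with t ht
      exact mul_nonneg (le_of_lt ht) (hpos _).le
    · filter_upwards [self_mem_nhdsWithin] with t ht
      exact mul_le_of_le_one_right (le_of_lt ht) (hle _)

/-- A countable sequence of germs converging in the germ topology `τ_δ`
is eventually germ-constant: eventually each `f i` agrees with `g` near `0`. -/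
theorem stmt5 {n : ℕ} (δ : Hyperreal) (hδpos : 0 < δ) (hδinf : δ.Infinitesimal)
    (f : ℕ → Euc n → ℝ) (g : Euc n → ℝ)
    (hconv : ∀ m ∈ SM, ∃ i₀ : ℕ, ∀ i : ℕ, i₀ ≤ i →
      ∀ ξ : NS (Euc n), germNorm ξ ≤ δ →
        |starApp (f i) ξ - starApp g ξ| < starFun m δ) :
    ∃ i₀ : ℕ, ∀ i : ℕ, i₀ ≤ i → f i =ᶠ[𝓝 (0 : Euc n)] g := by
  have hx (i k : ℕ) : ∃ x : Euc n, ¬ f i =ᶠ[𝓝 0] g →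
      ‖x‖ < 1 / ((k : ℝ) + 1) ∧ f i x ≠ g x := by
    by_cases h : f i =ᶠ[𝓝 0] g
    · exact ⟨0, fun h' => absurd h h'⟩
    · have hball := Metric.ball_mem_nhds (0 : Euc n) (Nat.one_div_pos_of_nat (α := ℝ) (n := k))
      obtain ⟨x, hne, hxk⟩ := ((not_eventually.mp h).and_eventually hball).exists
      exact ⟨x, fun _ => ⟨mem_ball_zero_iff.mp hxk, hne⟩⟩
  choose x hx using hx
  classical
  obtain ⟨c, hanti, hpos, hone, hle⟩ := exists_antitone_pos_diagonal_le
    (fun i k => if f i (x i k) = g (x i k) then 1 else |f i (x i k) - g (x i k)|) (by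
      intro i k
      split_ifs with h
      · exact one_pos
      · exact abs_pos.mpr (sub_ne_zero.mpr h))
  obtain ⟨i₀, hi₀⟩ := hconv _ (mul_comp_ceil_inv_mem_SM hanti hpos hone)
  refine ⟨i₀, fun i hi => ?_⟩
  by_contra hbad
  have hsmall : δ < ((1 / ((i : ℝ) + 1) : ℝ) : Hyperreal) := by
    have := (hδinf (1 / ((i : ℝ) + 1)) Nat.one_div_pos_of_nat).2
    simpa using this
  induction δ using Filter.Germ.inductionOn with | _ d
  have hd0 : ∀ᶠ j in (hyperfilter ℕ : Filter ℕ), 0 < d j := Filter.Germ.coe_lt.mp hδpos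
  have hd1 : ∀ᶠ j in (hyperfilter ℕ : Filter ℕ), d j < 1 / ((i : ℝ) + 1) :=
    Filter.Germ.coe_lt.mp hsmall
  have hnorm : germNorm (((fun j => x i ⌈(d j)⁻¹⌉₊ : ℕ → Euc n)) : NS (Euc n)) ≤
      Hyperreal.ofSeq d := by
    refine Filter.Germ.coe_le.mpr ?_
    filter_upwards [hd0] with j hj
    refine (hx i ⌈(d j)⁻¹⌉₊ hbad).1.le.trans ?_
    rw [one_div]
    exact inv_le_of_inv_le₀ hj ((Nat.le_ceil _).trans (by linarith))
  have hlt := hi₀ i hi _ hnorm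
  have hlt' : ∀ᶠ j in (hyperfilter ℕ : Filter ℕ),
      |f i (x i ⌈(d j)⁻¹⌉₊) - g (x i ⌈(d j)⁻¹⌉₊)| < d j * c ⌈(d j)⁻¹⌉₊ := by
    rw [abs_lt] at hlt
    filter_upwards [Filter.Germ.coe_lt.mp hlt.1, Filter.Germ.coe_lt.mp hlt.2] with j h₁ h₂
    exact abs_lt.mpr ⟨h₁, h₂⟩
  obtain ⟨j, hj0, hj1, hj⟩ := (hd0.and (hd1.and hlt')).exists
  have hiN : i ≤ ⌈(d j)⁻¹⌉₊ := by
    have h : (i : ℝ) + 1 ≤ (d j)⁻¹ := by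
      rw [one_div] at hj1
      exact (le_inv_comm₀ hj0 (by positivity)).mp hj1.le
    exact_mod_cast (by linarith [Nat.le_ceil (d j)⁻¹] : (i : ℝ) ≤ (⌈(d j)⁻¹⌉₊ : ℝ))
  have hc := hle i _ hiN
  rw [if_neg (hx i _ hbad).2] at hc
  have hd_le : d j ≤ 1 := by
    refine hj1.le.trans ((div_le_one (by positivity)).mpr ?_)
    linarith [Nat.cast_nonneg (α := ℝ) i]
  have := mul_le_of_le_one_left (hpos ⌈(d j)⁻¹⌉₊).le hd_le
  linarith
end

section
/- Let m : ℝ → ℝ and c ∈ ℝ be such that m is monotone nondecreasing on (c, ∞). Then there exist a strictly increasing sequence (n_j)_{j∈ℕ} of natural numbers and a sequence (b_j)_{j∈ℕ} of positive reals such that the series u(x) := Σ_{j=1}^∞ (x/b_j)^{n_j} converges absolutely for every x ∈ ℝ, every derivative of u is strictly positive on (0,∞), and u(x) > m(x) for all sufficiently large x. (Borel–Hardy: every function monotone near infinity is dominated near infinity by an everywhere-convergent power series with nonnegative coefficients.) -/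
open Filter Topology

/-- A series of monomials `∑ aⱼ x^{eⱼ}` with nonnegative coefficients that converges everywhere
can be differentiated termwise. -/
theorem hasDerivAt_tsum_mul_pow {a : ℕ → ℝ} {e : ℕ → ℕ} (ha : ∀ j, 0 ≤ a j)
    (hs : ∀ x : ℝ, Summable fun j => a j * x ^ e j) (x : ℝ) :
    (Summable fun j => a j * e j * x ^ (e j - 1)) ∧
      HasDerivAt (fun x => ∑' j, a j * x ^ e j) (∑' j, a j * e j * x ^ (e j - 1)) x := by
  set R : ℝ := |x| + 1
  have hR : 1 ≤ R := le_add_of_nonneg_left (abs_nonneg x)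
  have hbound : ∀ j, ∀ y ∈ Metric.ball (0 : ℝ) R,
      ‖a j * e j * y ^ (e j - 1)‖ ≤ a j * (2 * R) ^ e j := by
    intro j y hy
    have hy' : |y| ≤ R := by simpa using (mem_ball_zero_iff.1 hy).le
    have h1 : |y| ^ (e j - 1) ≤ R ^ e j :=
      (pow_le_pow_left₀ (abs_nonneg y) hy' _).trans (pow_le_pow_right₀ hR (Nat.sub_le _ _))
    have h2 : (e j : ℝ) ≤ 2 ^ e j := mod_cast (Nat.lt_two_pow_self (n := e j)).le
    rw [Real.norm_eq_abs, abs_mul, abs_mul, abs_pow, abs_of_nonneg (ha j), Nat.abs_cast, mul_assoc,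
      mul_pow]
    gcongr
    exact ha j
  have hx : x ∈ Metric.ball (0 : ℝ) R := by simp [R]
  refine ⟨.of_norm_bounded (hs (2 * R)) fun j => hbound j x hx, ?_⟩
  refine hasDerivAt_tsum_of_isPreconnected (hs (2 * R)) Metric.isOpen_ball
    (convex_ball 0 R).isPreconnected (fun j y _ => ?_) hbound hx (hs x) hx
  simpa [mul_assoc] using (hasDerivAt_pow (e j) y).const_mul (a j)

/-- All derivatives of an everywhere convergent series `∑ aⱼ x^{eⱼ}` with nonnegative, eventually
positive coefficients and exponents tending to infinity are positive on `(0, ∞)`. -/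
theorem iteratedDeriv_tsum_mul_pow_pos {a : ℕ → ℝ} {e : ℕ → ℕ} (ha : ∀ j, 0 ≤ a j)
    (ha' : ∀ᶠ j in atTop, 0 < a j) (he : Tendsto e atTop atTop)
    (hs : ∀ x : ℝ, Summable fun j => a j * x ^ e j) (k : ℕ) {x : ℝ} (hx : 0 < x) :
    0 < iteratedDeriv k (fun x => ∑' j, a j * x ^ e j) x := by
  induction k generalizing a e with
  | zero =>
    obtain ⟨j, hj⟩ := ha'.exists
    rw [iteratedDeriv_zero]
    exact (hs x).tsum_pos (fun i => mul_nonneg (ha i) (pow_nonneg hx.le _)) j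
      (mul_pos hj (pow_pos hx _))
  | succ k ih =>
    rw [iteratedDeriv_succ', funext fun y => (hasDerivAt_tsum_mul_pow ha hs y).2.deriv]
    refine ih (fun j => mul_nonneg (ha j) (Nat.cast_nonneg _)) ?_
      ((tendsto_sub_atTop_nat 1).comp he) fun y => (hasDerivAt_tsum_mul_pow ha hs y).1
    filter_upwards [ha', he.eventually_gt_atTop 0] with j h1 h2
    exact mul_pos h1 (Nat.cast_pos.2 h2)

/-- If `n` is strictly increasing, then `∑ (x / (j + 2)) ^ nⱼ` converges absolutely. -/
theorem summable_abs_div_add_two_pow {n : ℕ → ℕ} (hn : StrictMono n) (x : ℝ) :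
    Summable fun j : ℕ => |(x / (j + 2)) ^ n j| := by
  refine summable_geometric_two.of_norm_bounded_eventually_nat ?_
  filter_upwards [tendsto_natCast_atTop_atTop.eventually_ge_atTop (2 * |x|)] with j hj
  have hb : (0 : ℝ) < j + 2 := by positivity
  have h : |x / (j + 2)| ≤ 1 / 2 := by
    rw [abs_div, abs_of_pos hb, div_le_div_iff₀ hb two_pos]
    linarith
  rw [norm_abs_eq_norm, Real.norm_eq_abs, abs_pow]
  exact (pow_le_pow_left₀ (abs_nonneg _) h _).trans
    (pow_le_pow_of_le_one (by norm_num) (by norm_num) hn.le_apply)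

/-- Borel–Hardy. Every function monotone near infinity is dominated near
infinity by an everywhere absolutely convergent power series `u(x) = Σⱼ (x/bⱼ)^{nⱼ}` with
positive `bⱼ` and strictly increasing exponents, all of whose derivatives are strictly
positive on `(0,∞)`. -/
theorem stmt7 (m : ℝ → ℝ) (c : ℝ) (hm : MonotoneOn m (Set.Ioi c)) :
    ∃ nj : ℕ → ℕ, StrictMono nj ∧ ∃ b : ℕ → ℝ, (∀ j, 0 < b j) ∧
      (∀ x : ℝ, Summable (fun j : ℕ => |(x / b j) ^ nj j|)) ∧
      (∀ k : ℕ, ∀ x : ℝ, 0 < x →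
        0 < iteratedDeriv k (fun x : ℝ => ∑' j : ℕ, (x / b j) ^ nj j) x) ∧
      (∃ x₀ : ℝ, ∀ x : ℝ, x₀ ≤ x →
        m x < ∑' j : ℕ, (x / b j) ^ nj j) := by
  have hlarge : ∀ j : ℕ, ∀ᶠ n in atTop, m (j + 4) < (((j : ℝ) + 3) / (j + 2)) ^ n := fun j =>
    (tendsto_pow_atTop_atTop_of_one_lt
      ((one_lt_div (by positivity)).2 (by linarith))).eventually_gt_atTop _
  obtain ⟨n, hn, hmn⟩ := extraction_forall_of_eventually hlarge
  have hsum := summable_abs_div_add_two_pow hn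
  refine ⟨n, hn, fun j => j + 2, fun j => by positivity, hsum, fun k x hx => ?_, max 3 (c + 1),
    fun x hx => ?_⟩
  · have hterm : ∀ (y : ℝ) (j : ℕ),
        (y / (j + 2)) ^ n j = (((j : ℝ) + 2) ^ n j)⁻¹ * y ^ n j := fun y j => by
      rw [div_pow, div_eq_inv_mul]
    simp only [hterm]
    refine iteratedDeriv_tsum_mul_pow_pos (fun j => by positivity)
      (.of_forall fun j => by positivity) hn.tendsto_atTop (fun y => ?_) k hx
    simpa only [hterm] using (hsum y).of_abs
  · obtain ⟨h3, hc⟩ := max_le_iff.1 hx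
    set j := ⌊x - 3⌋₊
    have hj : (j : ℝ) + 3 ≤ x := by linarith [Nat.floor_le (sub_nonneg.2 h3)]
    have hj' : x < j + 4 := by linarith [Nat.lt_floor_add_one (x - 3)]
    calc m x ≤ m (j + 4) := hm (Set.mem_Ioi.2 (by linarith)) (Set.mem_Ioi.2 (by linarith)) hj'.le
      _ < (((j : ℝ) + 3) / (j + 2)) ^ n j := hmn j
      _ ≤ (x / (j + 2)) ^ n j := by gcongr
      _ ≤ ∑' i : ℕ, (x / (i + 2)) ^ n i :=
        (hsum x).of_abs.le_tsum j fun i _ => by positivity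
end

section
/- Let δ be a positive infinitesimal hyperreal and m ∈ SM. Then there exist a > 0 and a function u : ℝ → ℝ that is strictly increasing, strictly positive and real-analytic on the interval (0,a), with u(t) → 0 as t → 0⁺ (u may be taken of the form u(x) = 1/ū(1/x) for an everywhere-convergent power series ū with nonnegative coefficients), such that 0 < (*u)(δ) < (*m)(δ). (The moduli coming from the Hardy class of analytic monotone germs form a coinitial subset of SN_δ.) -/
open Filter Topology

/-- The terms `(R / (n + 1)) ^ K n` are summable as soon as the exponents satisfy `n ≤ K n`. -/
theorem summable_div_succ_pow {K : ℕ → ℕ} (hK : ∀ n, n ≤ K n) {R : ℝ} (hR : 0 ≤ R) :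
    Summable fun n : ℕ => (R / (n + 1)) ^ K n := by
  refine Summable.of_norm_bounded_eventually_nat (g := fun n : ℕ => (1 / 2 : ℝ) ^ n)
    summable_geometric_two ?_
  obtain ⟨N, hN⟩ := exists_nat_ge (2 * R)
  filter_upwards [eventually_ge_atTop N] with n hn
  have hn' : (N : ℝ) ≤ n := by exact_mod_cast hn
  have h0 : 0 ≤ R / ((n : ℝ) + 1) := by positivity
  have h1 : R / ((n : ℝ) + 1) ≤ 1 / 2 := by
    rw [div_le_div_iff₀ (by positivity) (by norm_num)]
    linarith
  rw [Real.norm_of_nonneg (pow_nonneg h0 _)]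
  calc (R / ((n : ℝ) + 1)) ^ K n ≤ (R / ((n : ℝ) + 1)) ^ n :=
        pow_le_pow_of_le_one h0 (by linarith) (hK n)
    _ ≤ (1 / 2) ^ n := pow_le_pow_left₀ h0 h1 n

/-- The sum of `(x / (n + 1)) ^ K n` is real-analytic as soon as `n ≤ K n`. -/
theorem analyticAt_tsum_div_succ_pow {K : ℕ → ℕ} (hK : ∀ n, n ≤ K n) (x : ℝ) :
    AnalyticAt ℝ (fun y : ℝ => ∑' n : ℕ, (y / (n + 1)) ^ K n) x := by
  have hdiff : DifferentiableOn ℂ (fun z : ℂ => ∑' n : ℕ, (z / (n + 1)) ^ K n)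
      (Metric.ball 0 (|x| + 1)) := by
    refine Complex.differentiableOn_tsum_of_summable_norm
      (summable_div_succ_pow hK (by positivity : 0 ≤ |x| + 1))
      (fun n => ((differentiable_id.div_const _).pow _).differentiableOn) Metric.isOpen_ball ?_
    intro n z hz
    have hz' : ‖z‖ ≤ |x| + 1 := by simpa using (Metric.mem_ball.1 hz).le
    have hn : ‖(n : ℂ) + 1‖ = (n : ℝ) + 1 := by
      exact_mod_cast Complex.norm_natCast (n + 1)
    rw [norm_pow, norm_div, hn]
    gcongr
  have han := (hdiff.analyticAt (Metric.isOpen_ball.mem_nhds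
    (by simp : (x : ℂ) ∈ Metric.ball (0 : ℂ) (|x| + 1)))).re_ofReal
  refine han.congr (Eventually.of_forall fun y => ?_)
  have hy : (∑' n : ℕ, ((y : ℂ) / (n + 1)) ^ K n)
      = ((∑' n : ℕ, (y / (n + 1)) ^ K n : ℝ) : ℂ) := by
    push_cast
    rfl
  simp only [hy, Complex.ofReal_re]

/-- Real-analytic increasing functions can outgrow any prescribed sequence. -/
theorem exists_analytic_strictMonoOn_gt (G : ℕ → ℝ) :
    ∃ H : ℝ → ℝ, (∀ x, AnalyticAt ℝ H x) ∧ StrictMonoOn H (Set.Ici 0) ∧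
      (∀ x, 0 ≤ x → x ≤ H x) ∧ ∀ (n : ℕ) (x : ℝ), (n : ℝ) + 2 ≤ x → G n < H x := by
  have hex : ∀ n : ℕ, ∃ k : ℕ, n ≤ k ∧ G n ≤ (((n : ℝ) + 2) / (n + 1)) ^ k := by
    intro n
    have h1 : 1 < ((n : ℝ) + 2) / (n + 1) := by
      rw [one_lt_div (by positivity)]
      linarith
    obtain ⟨k, hk⟩ := pow_unbounded_of_one_lt (G n) h1
    exact ⟨max n k, le_max_left _ _,
      hk.le.trans (pow_le_pow_right₀ h1.le (le_max_right _ _))⟩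
  choose K hK hG using hex
  have hnonneg : ∀ x : ℝ, 0 ≤ x → ∀ n : ℕ, 0 ≤ (x / ((n : ℝ) + 1)) ^ K n :=
    fun x hx n => by positivity
  refine ⟨fun x => x + ∑' n : ℕ, (x / (n + 1)) ^ K n, fun x =>
    analyticAt_id.add (analyticAt_tsum_div_succ_pow hK x), ?_, ?_, ?_⟩
  · intro x hx y hy hxy
    have hx : 0 ≤ x := hx
    refine add_lt_add_of_lt_of_le hxy ((summable_div_succ_pow hK hx).tsum_le_tsum
      (fun n => ?_) (summable_div_succ_pow hK hy))
    gcongr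
  · intro x hx
    exact le_add_of_nonneg_right (tsum_nonneg (hnonneg x hx))
  · intro n x hx
    have hx0 : 0 < x := by linarith [(Nat.cast_nonneg n : (0 : ℝ) ≤ n)]
    have hterm := (summable_div_succ_pow hK hx0.le).le_tsum n fun j _ => hnonneg x hx0.le j
    have hpow : (((n : ℝ) + 2) / (n + 1)) ^ K n ≤ (x / (n + 1)) ^ K n := by gcongr
    change G n < x + _
    linarith [hG n]

/-- Below every modulus there is an analytic one, on a whole right neighbourhood of `0`. -/
theorem SMOn.exists_analytic_lt {m : ℝ → ℝ} {a : ℝ} (hm : SMOn m a) :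
    ∃ u : ℝ → ℝ, SMOn u a ∧ AnalyticOnNhd ℝ u (Set.Ioo 0 a) ∧
      ∀ t, 0 < t → t < a → t < 1 / 3 → u t < m t := by
  obtain ⟨ha, hmono, hpos, -⟩ := hm
  obtain ⟨H, hHan, hHmono, hHge, hHG⟩ :=
    exists_analytic_strictMonoOn_gt fun n => (m (1 / ((n : ℝ) + 3)))⁻¹
  have hHpos : ∀ t : ℝ, 0 < t → 0 < H t⁻¹ := fun t ht =>
    (inv_pos.2 ht).trans_le (hHge _ (inv_pos.2 ht).le)
  have hupos : ∀ t : ℝ, 0 < t → 0 < (H t⁻¹)⁻¹ := fun t ht => inv_pos.2 (hHpos t ht)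
  refine ⟨fun t => (H t⁻¹)⁻¹, ⟨ha, ?_, fun t ht => hupos t ht.1, ?_⟩, ?_, ?_⟩
  · intro s hs t ht hst
    exact inv_strictAnti₀ (hHpos t ht.1) (hHmono (inv_pos.2 ht.1).le (inv_pos.2 hs.1).le
      (inv_strictAnti₀ hs.1 hst))
  · refine tendsto_of_tendsto_of_tendsto_of_le_of_le' tendsto_const_nhds
      (tendsto_nhdsWithin_of_tendsto_nhds tendsto_id) ?_ ?_
    · filter_upwards [self_mem_nhdsWithin] with t ht using (hupos t ht).le
    · filter_upwards [self_mem_nhdsWithin] with t ht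
      exact inv_le_of_inv_le₀ ht (hHge _ (inv_pos.2 ht).le)
  · intro t ht
    exact ((hHan t⁻¹).fun_comp (analyticAt_inv ht.1.ne')).inv (hHpos t ht.1).ne'
  · intro t ht hta ht3
    have h3 : (3 : ℝ) < t⁻¹ := by
      rw [lt_inv_comm₀ (by norm_num) ht]
      linarith
    obtain ⟨n, hn⟩ : ∃ n : ℕ, ⌊t⁻¹⌋₊ = n + 2 :=
      ⟨⌊t⁻¹⌋₊ - 2, by
        have : 2 ≤ ⌊t⁻¹⌋₊ := Nat.le_floor (by push_cast; linarith)
        omega⟩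
    have hle : (n : ℝ) + 2 ≤ t⁻¹ := by
      have := Nat.floor_le (inv_pos.2 ht).le
      rw [hn] at this
      exact_mod_cast this
    have hlt : t⁻¹ < (n : ℝ) + 3 := by
      have := Nat.lt_floor_add_one t⁻¹
      rw [hn] at this
      push_cast at this
      linarith
    have hs0 : 0 < 1 / ((n : ℝ) + 3) := by positivity
    have hst : 1 / ((n : ℝ) + 3) < t := by
      rw [one_div]
      exact inv_lt_of_inv_lt₀ ht hlt
    have hsmem : 1 / ((n : ℝ) + 3) ∈ Set.Ioo 0 a := ⟨hs0, hst.trans hta⟩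
    exact (inv_lt_of_inv_lt₀ (hpos _ hsmem) (hHG n _ hle)).trans (hmono hsmem ⟨ht, hta⟩ hst)

/-- Hardy-class (analytic, strictly monotone) moduli are coinitial in
`SN_δ`: below every modulus value `(*m)(δ)` there is a positive value `(*u)(δ)` of an
analytic element `u` of `SM`. -/
theorem stmt8 (δ : Hyperreal) (hδpos : 0 < δ) (hδinf : δ.Infinitesimal)
    (m : ℝ → ℝ) (hm : m ∈ SM) :
    ∃ a : ℝ, 0 < a ∧ ∃ u : ℝ → ℝ,
      StrictMonoOn u (Set.Ioo 0 a) ∧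
      (∀ t ∈ Set.Ioo 0 a, 0 < u t) ∧
      AnalyticOnNhd ℝ u (Set.Ioo 0 a) ∧
      Filter.Tendsto u (𝓝[>] (0:ℝ)) (𝓝 0) ∧
      0 < starFun u δ ∧ starFun u δ < starFun m δ := by
  obtain ⟨a, ha⟩ := hm
  obtain ⟨u, ⟨ha0, humono, hupos, hulim⟩, huan, hlt⟩ := ha.exists_analytic_lt
  refine ⟨a, ha0, u, humono, hupos, huan, hulim, ?_⟩
  obtain ⟨d, rfl⟩ := Hyperreal.ofSeq_surjective δ
  have hd0 : ∀ᶠ n in hyperfilter ℕ, 0 < d n := Hyperreal.ofSeq_lt_ofSeq.1 hδpos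
  have hda : ∀ᶠ n in hyperfilter ℕ, d n < min a (1 / 3) :=
    Hyperreal.ofSeq_lt_ofSeq.1
      (Hyperreal.lt_of_pos_of_infinitesimal hδinf _ (lt_min ha0 (by norm_num)))
  constructor
  · refine (Hyperreal.ofSeq_lt_ofSeq (f := fun _ => 0) (g := fun n => u (d n))).2 ?_
    filter_upwards [hd0, hda] with n h0 h1
    exact hupos _ ⟨h0, h1.trans_le (min_le_left _ _)⟩
  · refine (Hyperreal.ofSeq_lt_ofSeq (f := fun n => u (d n)) (g := fun n => m (d n))).2 ?_
    filter_upwards [hd0, hda] with n h0 h1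
    exact hlt _ h0 (h1.trans_le (min_le_left _ _)) (h1.trans_le (min_le_right _ _))
end

section
/- Let δ be a positive infinitesimal hyperreal and let m ∈ SM be in addition continuous on its interval (0,a) of monotonicity. Then: (i) SN_{(*m)(δ)} = SN_δ, i.e. {(*u)((*m)(δ)) : u ∈ SM} = {(*u)(δ) : u ∈ SM}; and (ii) (*m) maps SN_δ onto SN_δ, i.e. {(*m)((*u)(δ)) : u ∈ SM} = {(*u)(δ) : u ∈ SM}. -/
open Filter Topology

/-- A modulus sends positive arguments tending to `0` to positive values tending to `0`. -/
theorem SMOn.tendsto_nhdsGT {m : ℝ → ℝ} {a : ℝ} (hm : SMOn m a) :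
    Tendsto m (𝓝[>] (0 : ℝ)) (𝓝[>] 0) :=
  tendsto_nhdsWithin_iff.2 ⟨hm.2.2.2, by
    filter_upwards [Ioo_mem_nhdsGT hm.1] with t ht using hm.2.2.1 t ht⟩

theorem SM_comp {u m : ℝ → ℝ} (hu : u ∈ SM) (hm : m ∈ SM) : u ∘ m ∈ SM := by
  obtain ⟨b, hu⟩ := hu
  obtain ⟨a, hm⟩ := hm
  have hev : ∀ᶠ t in 𝓝[>] (0 : ℝ), m t ∈ Set.Ioo 0 b :=
    hm.tendsto_nhdsGT.eventually (Ioo_mem_nhdsGT hu.1)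
  obtain ⟨c, hc, hcb⟩ := mem_nhdsGT_iff_exists_Ioo_subset.1 hev
  have hca : ∀ t ∈ Set.Ioo 0 (min a c), t ∈ Set.Ioo 0 a ∧ m t ∈ Set.Ioo 0 b := fun t ht =>
    ⟨⟨ht.1, ht.2.trans_le (min_le_left _ _)⟩, hcb ⟨ht.1, ht.2.trans_le (min_le_right _ _)⟩⟩
  exact ⟨min a c, lt_min hm.1 hc,
    fun s hs t ht hst =>
      hu.2.1 (hca s hs).2 (hca t ht).2 (hm.2.1 (hca s hs).1 (hca t ht).1 hst),
    fun t ht => hu.2.2.1 _ (hca t ht).2, hu.2.2.2.comp hm.tendsto_nhdsGT⟩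

/-- A continuous modulus has a two-sided inverse modulus near `0`. -/
theorem SMOn.exists_inverse {m : ℝ → ℝ} {a : ℝ} (hm : SMOn m a)
    (hc : ContinuousOn m (Set.Ioo 0 a)) :
    ∃ v ∈ SM, (∀ᶠ t in 𝓝[>] (0 : ℝ), v (m t) = t) ∧ ∀ᶠ s in 𝓝[>] (0 : ℝ), m (v s) = s := by
  have ha := hm.1
  have hmid : a / 2 ∈ Set.Ioo 0 a := ⟨half_pos ha, half_lt_self ha⟩
  have hb : 0 < m (a / 2) := hm.2.2.1 _ hmid
  have hsurj : ∀ s ∈ Set.Ioo 0 (m (a / 2)), ∃ t ∈ Set.Ioo 0 a, m t = s := by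
    intro s hs
    have hev : ∀ᶠ t in 𝓝[>] (0 : ℝ), m t ∈ Set.Ioo 0 s :=
      hm.tendsto_nhdsGT.eventually (Ioo_mem_nhdsGT hs.1)
    obtain ⟨t, hts, ht⟩ := (hev.and (Ioo_mem_nhdsGT ha)).exists
    exact isPreconnected_Ioo.intermediate_value ht hmid hc ⟨hts.2.le, hs.2.le⟩
  choose! v hv hmv using hsurj
  have hvm : ∀ t ∈ Set.Ioo 0 a, m t ∈ Set.Ioo 0 (m (a / 2)) → v (m t) = t := fun t ht hmt =>
    hm.2.1.injOn (hv _ hmt) ht (hmv _ hmt)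
  have hmono : StrictMonoOn v (Set.Ioo 0 (m (a / 2))) := fun s hs t ht hst =>
    (hm.2.1.lt_iff_lt (hv s hs) (hv t ht)).1 (by rwa [hmv s hs, hmv t ht])
  refine ⟨v, ⟨m (a / 2), hb, hmono, fun s hs => (hv s hs).1, ?_⟩, ?_, ?_⟩
  · rw [tendsto_order]
    refine ⟨fun l hl => ?_, fun e he => ?_⟩
    · filter_upwards [Ioo_mem_nhdsGT hb] with s hs using hl.trans (hv s hs).1
    · obtain ⟨t, ht0, ht⟩ := exists_between (lt_min he ha)
      have hta : t ∈ Set.Ioo 0 a := ⟨ht0, ht.trans_le (min_le_right _ _)⟩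
      filter_upwards [Ioo_mem_nhdsGT hb, Ioo_mem_nhdsGT (hm.2.2.1 t hta)] with s hs hst
      refine lt_trans ?_ (ht.trans_le (min_le_left _ _))
      exact (hm.2.1.lt_iff_lt (hv s hs) hta).1 (by rw [hmv s hs]; exact hst.2)
  · filter_upwards [Ioo_mem_nhdsGT ha,
      hm.tendsto_nhdsGT.eventually (Ioo_mem_nhdsGT hb)] with t ht hmt using hvm t ht hmt
  · filter_upwards [Ioo_mem_nhdsGT hb] with s hs using hmv s hs

theorem starFun_comp (f g : ℝ → ℝ) (δ : Hyperreal) :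
    starFun (f ∘ g) δ = starFun f (starFun g δ) :=
  (Filter.Germ.map_map f g δ).symm

/-- Functions that agree on a right neighbourhood of `0` have the same star at every
positive infinitesimal. -/
theorem starFun_congr {f g : ℝ → ℝ} (h : f =ᶠ[𝓝[>] (0 : ℝ)] g) {δ : Hyperreal}
    (hδpos : 0 < δ) (hδinf : δ.Infinitesimal) : starFun f δ = starFun g δ := by
  obtain ⟨c, hc, hsub⟩ := mem_nhdsGT_iff_exists_Ioo_subset.1 h
  have hlt : δ < (c : Hyperreal) := Hyperreal.lt_of_pos_of_infinitesimal hδinf c hc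
  induction δ using Germ.inductionOn with
  | _ d =>
    have h0 : ∀ᶠ n in (hyperfilter ℕ : Filter ℕ), 0 < d n := Germ.coe_lt.1 hδpos
    have h1 : ∀ᶠ n in (hyperfilter ℕ : Filter ℕ), d n < c := Germ.coe_lt.1 hlt
    refine Germ.coe_eq.2 ?_
    filter_upwards [h0, h1] with n hn0 hn1 using hsub ⟨hn0, hn1⟩

/-- For a continuous modulus `m`, (i) the moduli at `(*m)(δ)` coincide
with the moduli at `δ`, and (ii) `*m` maps `SN_δ` onto `SN_δ`. -/
theorem stmt9 (δ : Hyperreal) (hδpos : 0 < δ) (hδinf : δ.Infinitesimal)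
    (m : ℝ → ℝ) (a : ℝ) (hm : SMOn m a) (hc : ContinuousOn m (Set.Ioo 0 a)) :
    SN (starFun m δ) = SN δ ∧
    {x : Hyperreal | ∃ u ∈ SM, starFun m (starFun u δ) = x} = SN δ := by
  have hmSM : m ∈ SM := ⟨a, hm⟩
  obtain ⟨v, hv, hvm, hmv⟩ := hm.exists_inverse hc
  refine ⟨Set.ext fun x => ⟨?_, ?_⟩, Set.ext fun x => ⟨?_, ?_⟩⟩
  · rintro ⟨u, hu, rfl⟩
    exact ⟨u ∘ m, SM_comp hu hmSM, starFun_comp u m δ⟩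
  · rintro ⟨u, hu, rfl⟩
    refine ⟨u ∘ v, SM_comp hu hv, ?_⟩
    rw [← starFun_comp]
    refine starFun_congr ?_ hδpos hδinf
    filter_upwards [hvm] with t ht using congrArg u ht
  · rintro ⟨u, hu, rfl⟩
    exact ⟨m ∘ u, SM_comp hmSM hu, starFun_comp m u δ⟩
  · rintro ⟨u, hu, rfl⟩
    refine ⟨v ∘ u, SM_comp hv hu, ?_⟩
    rw [← starFun_comp]
    obtain ⟨b, hub⟩ := hu
    refine starFun_congr ?_ hδpos hδinf
    filter_upwards [hub.tendsto_nhdsGT hmv] with t ht using ht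
end

section
/- Let r > 0, let h : ℝⁿ → ℝᵖ be continuous on the closed ball of radius r about 0, and let δ be a positive infinitesimal hyperreal. Then for every m ∈ SM there exists m̄ ∈ SM such that for all ξ, ζ ∈ *ℝⁿ with ‖ξ‖ ≤ δ, ‖ζ‖ ≤ δ and ‖ξ − ζ‖ < (*m̄)(δ), one has ‖(*h)(ξ) − (*h)(ζ)‖ < (*m)(δ). -/
open Filter Topology

/-- A uniformly continuous map admits, for every target modulus `m`, a source modulus `mb` such that
`mb t`-close points have `m t`-close images, for all small positive `t`. -/
theorem UniformContinuousOn.exists_mem_SM {X Y : Type*} [PseudoMetricSpace X] [PseudoMetricSpace Y]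
    {f : X → Y} {s : Set X} (hf : UniformContinuousOn f s) {m : ℝ → ℝ} (hm : m ∈ SM) :
    ∃ mb ∈ SM, ∃ c > 0, ∀ t ∈ Set.Ioo 0 c, ∀ x ∈ s, ∀ y ∈ s,
      dist x y < mb t → dist (f x) (f y) < m t := by
  obtain ⟨a, ha, hmono, hpos, -⟩ := hm
  let S : ℝ → Set ℝ := fun t =>
    {d | 0 < d ∧ d ≤ 1 ∧ ∀ x ∈ s, ∀ y ∈ s, dist x y < d → dist (f x) (f y) < m t}
  have hbdd (t : ℝ) : BddAbove (S t) := ⟨1, fun d hd => hd.2.1⟩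
  have hne : ∀ t ∈ Set.Ioo 0 a, (S t).Nonempty := by
    intro t ht
    obtain ⟨d, hd, hfd⟩ := Metric.uniformContinuousOn_iff.1 hf (m t) (hpos t ht)
    exact ⟨min d 1, lt_min hd one_pos, min_le_right _ _,
      fun x hx y hy hxy => hfd x hx y hy (hxy.trans_le (min_le_left _ _))⟩
  have hDpos : ∀ t ∈ Set.Ioo 0 a, 0 < sSup (S t) := by
    intro t ht
    obtain ⟨d, hd⟩ := hne t ht
    exact hd.1.trans_le (le_csSup (hbdd t) hd)
  have hD_nonneg (t : ℝ) : 0 ≤ sSup (S t) := Real.sSup_nonneg fun d hd => hd.1.le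
  have hD_le (t : ℝ) : sSup (S t) ≤ 1 := Real.sSup_le (fun d hd => hd.2.1) zero_le_one
  refine ⟨fun t => t * sSup (S t), ⟨a, ha, ?_, fun t ht => mul_pos ht.1 (hDpos t ht), ?_⟩,
    min a 1, lt_min ha one_pos, ?_⟩
  · intro t ht u hu htu
    have hSS : S t ⊆ S u := fun d hd =>
      ⟨hd.1, hd.2.1, fun x hx y hy hxy => (hd.2.2 x hx y hy hxy).trans (hmono ht hu htu)⟩
    exact mul_lt_mul htu (csSup_le_csSup (hbdd u) (hne t ht) hSS) (hDpos t ht) hu.1.le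
  · refine tendsto_of_tendsto_of_tendsto_of_le_of_le' tendsto_const_nhds
      (tendsto_id.mono_left nhdsWithin_le_nhds) ?_ ?_
    · filter_upwards [self_mem_nhdsWithin] with t ht
      exact mul_nonneg (le_of_lt ht) (hD_nonneg t)
    · filter_upwards [self_mem_nhdsWithin] with t ht
      exact mul_le_of_le_one_right (le_of_lt ht) (hD_le t)
  · intro t ht x hx y hy hxy
    have hta : t ∈ Set.Ioo 0 a := ⟨ht.1, ht.2.trans_le (min_le_left _ _)⟩
    have ht1 : t ≤ 1 := (ht.2.trans_le (min_le_right _ _)).le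
    obtain ⟨d, hd, hxyd⟩ := exists_lt_of_lt_csSup (hne t hta)
      (hxy.trans_le (mul_le_of_le_one_left (hD_nonneg t) ht1))
    exact hd.2.2 x hx y hy hxyd

/-- Nonstandard uniform continuity on the infinitesimal ball: for every
modulus `m` there is a modulus `m̄` such that `δ`-close star points (within the ball of
radius `δ`, at distance `< (*m̄)(δ)`) have star images at distance `< (*m)(δ)`. -/
theorem stmt12 {n p : ℕ} (r : ℝ) (hr : 0 < r) (h : Euc n → Euc p)
    (hcont : ContinuousOn h (Metric.closedBall (0 : Euc n) r))
    (δ : Hyperreal) (hδpos : 0 < δ) (hδinf : δ.Infinitesimal) :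
    ∀ m ∈ SM, ∃ mb ∈ SM,
      ∀ ξ ζ : NS (Euc n), germNorm ξ ≤ δ → germNorm ζ ≤ δ →
        germNorm (ξ - ζ) < starFun mb δ →
        germNorm (starMap h ξ - starMap h ζ) < starFun m δ := by
  intro m hm
  have huc := (isCompact_closedBall (0 : Euc n) r).uniformContinuousOn_of_continuous hcont
  obtain ⟨mb, hmb, c, hc, hclose⟩ := huc.exists_mem_SM hm
  refine ⟨mb, hmb, fun ξ ζ hξ hζ hξζ => ?_⟩
  have hδlt : δ < ((min c r : ℝ) : Hyperreal) := by
    simpa using (hδinf (min c r) (lt_min hc hr)).2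
  induction ξ using Filter.Germ.inductionOn with | _ x
  induction ζ using Filter.Germ.inductionOn with | _ y
  obtain ⟨d, rfl⟩ := Hyperreal.ofSeq_surjective δ
  have h0 := (Hyperreal.ofSeq_lt_ofSeq (f := fun _ => 0)).1 hδpos
  have h1 := (Hyperreal.ofSeq_lt_ofSeq (g := fun _ => min c r)).1 hδlt
  have h2 := (Hyperreal.ofSeq_le_ofSeq (f := fun k => ‖x k‖)).1 hξ
  have h3 := (Hyperreal.ofSeq_le_ofSeq (f := fun k => ‖y k‖)).1 hζ
  have h4 := (Hyperreal.ofSeq_lt_ofSeq (f := fun k => ‖x k - y k‖) (g := fun k => mb (d k))).1 hξζ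
  refine (Hyperreal.ofSeq_lt_ofSeq (f := fun k => ‖h (x k) - h (y k)‖)
    (g := fun k => m (d k))).2 ?_
  filter_upwards [h0, h1, h2, h3, h4] with k h0 h1 h2 h3 h4
  have hdr : d k ≤ r := (h1.trans_le (min_le_right _ _)).le
  rw [← dist_eq_norm] at h4 ⊢
  exact hclose (d k) ⟨h0, h1.trans_le (min_le_left _ _)⟩ (x k)
    (mem_closedBall_zero_iff.2 (h2.trans hdr)) (y k) (mem_closedBall_zero_iff.2 (h3.trans hdr)) h4
end

section
/- Let k ∈ ℕ, let U ⊆ ℝⁿ be open, and let 𝔉 be an internal function of class SC^k on U. Then its standard part °𝔉 is of class C^k on U, and for every multi-index α with |α| ≤ k and every x ∈ U one has ∂^α(°𝔉)(x) = st((∂^α𝔉)(*x)); in particular taking standard parts commutes with differentiation up to order k. -/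
open Filter Topology

noncomputable section
/-- Internal functions on `ℝⁿ`: germs of sequences of functions. -/
abbrev IntFun (n : ℕ) := Filter.Germ (Filter.hyperfilter ℕ : Filter ℕ) (Euc n → ℝ)

/-- Application of an internal function at a nonstandard point (binary germ-lift). -/
def iapp {n : ℕ} (F : IntFun n) (ξ : NS (Euc n)) : Hyperreal :=
  Filter.Germ.map₂ (fun f x => f x) F ξ

/-- `ξ` is nearstandard in the open set `U`. -/
def NearStd {n : ℕ} (U : Set (Euc n)) (ξ : NS (Euc n)) : Prop :=
  ∃ x ∈ U, (germNorm (ξ - starPt x)).Infinitesimal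

/-- Infinitesimal closeness of nonstandard points. -/
def InfClose {n : ℕ} (ξ ζ : NS (Euc n)) : Prop :=
  (germNorm (ξ - ζ)).Infinitesimal

/-- A hyperreal is finite when bounded in absolute value by a standard real. -/
def HFin (x : Hyperreal) : Prop := ∃ r : ℝ, |x| ≤ (r : Hyperreal)

/-- Partial derivative in the `i`-th coordinate direction. -/
noncomputable def pderivCoord {n : ℕ} (i : Fin n) (f : Euc n → ℝ) : Euc n → ℝ :=
  fun x => fderiv ℝ f x (EuclideanSpace.single i (1 : ℝ))

/-- Iterated partial derivative `∂^α` along the multi-index (list of coordinates) `α`. -/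
noncomputable def pderivMulti {n : ℕ} : List (Fin n) → (Euc n → ℝ) → Euc n → ℝ
  | [], f => f
  | i :: L, f => pderivCoord i (pderivMulti L f)

/-- Internal iterated partial derivative `∂^α 𝔉` of an internal function. -/
noncomputable def intDeriv {n : ℕ} (L : List (Fin n)) (F : IntFun n) : IntFun n :=
  F.map (pderivMulti L)

/-- An internal function is of class `SC^k` on the open set `U`: it is the germ of a
sequence of `C^k` functions on `U` all of whose internal derivatives of order `≤ k` are
finite at nearstandard points of `U` and S-continuous there. -/
def SCk {n : ℕ} (k : ℕ) (U : Set (Euc n)) (F : IntFun n) : Prop :=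
  ∃ Fs : ℕ → Euc n → ℝ, F = ↑Fs ∧ (∀ i : ℕ, ContDiffOn ℝ k (Fs i) U) ∧
    ∀ L : List (Fin n), L.length ≤ k →
      (∀ ξ : NS (Euc n), NearStd U ξ → HFin (iapp (intDeriv L F) ξ)) ∧
      (∀ ξ ζ : NS (Euc n), NearStd U ξ → NearStd U ζ → InfClose ξ ζ →
        (iapp (intDeriv L F) ξ - iapp (intDeriv L F) ζ).Infinitesimal)

/-- The standard part of an internal function: `°𝔉(x) = st(𝔉(*x))`. -/
noncomputable def stdPart {n : ℕ} (F : IntFun n) : Euc n → ℝ :=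
  fun x => (iapp F (starPt x)).st
end
/-- Convergence along every `hyperfilter`-convergent sequence of points implies continuous
convergence, i.e. convergence along the product filter. -/
theorem tendsto_hyperfilter_prod_nhds_of_seq {E X : Type*} [PseudoMetricSpace E]
    [TopologicalSpace X] {G : ℕ → E → X} {x : E} {c : X}
    (h : ∀ y : ℕ → E, Tendsto y (hyperfilter ℕ : Filter ℕ) (𝓝 x) →
      Tendsto (fun i => G i (y i)) (hyperfilter ℕ : Filter ℕ) (𝓝 c)) :
    Tendsto (fun p : ℕ × E => G p.1 p.2) ((hyperfilter ℕ : Filter ℕ) ×ˢ 𝓝 x) (𝓝 c) := by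
  classical
  by_contra hG
  obtain ⟨V, hV, hVG⟩ : ∃ V ∈ 𝓝 c,
      ¬ ∀ᶠ p in (hyperfilter ℕ : Filter ℕ) ×ˢ 𝓝 x, G p.1 p.2 ∈ V := by
    simpa only [Filter.tendsto_def, not_forall, exists_prop, Filter.Eventually,
      Set.preimage] using hG
  let P : ℕ → ℕ → Prop := fun i m => ∃ y ∈ Metric.ball x (1 / ((m : ℝ) + 1)), G i y ∉ V
  have hP : ∀ m, ∀ᶠ i in (hyperfilter ℕ : Filter ℕ), P i m := by
    intro m
    by_contra hm
    rw [← Ultrafilter.eventually_not] at hm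
    refine hVG ?_
    filter_upwards [hm.prod_mk (Metric.ball_mem_nhds x (Nat.one_div_pos_of_nat (n := m)))]
      with p hp
    by_contra hpV
    exact hp.1 ⟨p.2, hp.2, hpV⟩
  let M : ℕ → ℕ := fun i => Nat.findGreatest (P i) i
  have hM : ∀ᶠ i in (hyperfilter ℕ : Filter ℕ), P i (M i) :=
    (hP 0).mono fun i hi => Nat.findGreatest_spec (Nat.zero_le i) hi
  have hMtop : ∀ m, ∀ᶠ i in (hyperfilter ℕ : Filter ℕ), m ≤ M i := by
    intro m
    filter_upwards [hP m, Nat.hyperfilter_le_atTop (eventually_ge_atTop m)] with i hi hmi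
    exact Nat.le_findGreatest hmi hi
  let y : ℕ → E := fun i => if hi : P i (M i) then hi.choose else x
  have hy : ∀ i, P i (M i) → y i ∈ Metric.ball x (1 / ((M i : ℝ) + 1)) ∧ G i (y i) ∉ V := by
    intro i hi
    simpa only [y, dif_pos hi] using hi.choose_spec
  have hyx : Tendsto y (hyperfilter ℕ : Filter ℕ) (𝓝 x) := by
    rw [Metric.tendsto_nhds]
    intro ε hε
    obtain ⟨m, hm⟩ := exists_nat_one_div_lt hε
    filter_upwards [hM, hMtop m] with i hi hmi
    calc dist (y i) x < 1 / ((M i : ℝ) + 1) := (hy i hi).1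
      _ ≤ 1 / ((m : ℝ) + 1) := Nat.one_div_le_one_div hmi
      _ < ε := hm
  obtain ⟨i, hi, hiV⟩ := (hM.and (h y hyx hV)).exists
  exact (hy i hi).2 hiV

/-- A continuous limit which is also a pointwise limit nearby is continuous. -/
theorem continuousAt_of_tendsto_prod_nhds {ι E : Type*} [TopologicalSpace E] {l : Filter ι}
    [l.NeBot] {G : ι → E → ℝ} {g : E → ℝ} {x : E}
    (h : Tendsto (fun p : ι × E => G p.1 p.2) (l ×ˢ 𝓝 x) (𝓝 (g x)))
    (hg : ∀ᶠ y in 𝓝 x, Tendsto (fun i => G i y) l (𝓝 (g y))) : ContinuousAt g x := by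
  rw [ContinuousAt, (closed_nhds_basis (g x)).tendsto_right_iff]
  rintro V ⟨hV, hVc⟩
  have hev : ∀ᶠ y in 𝓝 x, ∀ᶠ i in l, G i y ∈ V :=
    ((h.comp tendsto_prod_swap).eventually hV).curry
  filter_upwards [hev, hg] with y hy hgy
  exact hVc.mem_of_tendsto hgy hy

theorem Hyperreal.tendsto_st_of_HFin {a : ℕ → ℝ} (ha : HFin (Hyperreal.ofSeq a)) :
    Tendsto a (hyperfilter ℕ : Filter ℕ) (𝓝 (Hyperreal.ofSeq a).st) := by
  obtain ⟨r, hr⟩ := ha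
  refine Hyperreal.isSt_ofSeq_iff_tendsto.1 (Hyperreal.isSt_st' ?_)
  rw [Hyperreal.not_infinite_iff_exist_lt_gt]
  refine ⟨-r - 1, r + 1, ?_, ?_⟩
  · have := (abs_le.1 hr).1
    push_cast
    linarith
  · have := (abs_le.1 hr).2
    push_cast
    linarith

theorem infinitesimal_germNorm_sub {E : Type*} [NormedAddCommGroup E] {y z : ℕ → E} :
    (germNorm ((y : NS E) - (z : NS E))).Infinitesimal ↔
      Tendsto (fun i => y i - z i) (hyperfilter ℕ : Filter ℕ) (𝓝 0) := by
  rw [tendsto_zero_iff_norm_tendsto_zero]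
  exact Hyperreal.isSt_ofSeq_iff_tendsto

theorem clm_eq_sum_single_smul_proj {n : ℕ} (A : Euc n →L[ℝ] ℝ) :
    A = ∑ j, A (EuclideanSpace.single j (1 : ℝ)) • (EuclideanSpace.proj j : Euc n →L[ℝ] ℝ) := by
  refine ContinuousLinearMap.coe_injective ((EuclideanSpace.basisFun (Fin n) ℝ).toBasis.ext ?_)
  intro i
  simp

theorem fderiv_eq_sum_pderivCoord {n : ℕ} (f : Euc n → ℝ) (x : Euc n) :
    fderiv ℝ f x = ∑ j, pderivCoord j f x • (EuclideanSpace.proj j : Euc n →L[ℝ] ℝ) :=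
  clm_eq_sum_single_smul_proj _

theorem contDiffOn_pderivMulti {n : ℕ} {U : Set (Euc n)} (hU : IsOpen U) {f : Euc n → ℝ} :
    ∀ (L : List (Fin n)) (m : ℕ), ContDiffOn ℝ ((L.length + m : ℕ) : ℕ∞) f U →
      ContDiffOn ℝ m (pderivMulti L f) U
  | [], m, hf => by simpa [pderivMulti] using hf
  | i :: L, m, hf => by
    have hL := contDiffOn_pderivMulti hU L (m + 1) (by
      rwa [List.length_cons, Nat.add_right_comm] at hf)
    exact (hL.fderiv_of_isOpen hU (m := m) (by norm_cast)).clm_apply contDiffOn_const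

section StandardPart

variable {n k : ℕ} {U : Set (Euc n)} {Fs : ℕ → Euc n → ℝ}

/-- The derivatives of a sequence representing an `SC^k` function converge continuously. -/
theorem tendsto_pderivMulti_prod_nhds {F : IntFun n} (hF : F = ↑Fs) {L : List (Fin n)}
    (hfin : ∀ ξ : NS (Euc n), NearStd U ξ → HFin (iapp (intDeriv L F) ξ))
    (hS : ∀ ξ ζ : NS (Euc n), NearStd U ξ → NearStd U ζ → InfClose ξ ζ →
      (iapp (intDeriv L F) ξ - iapp (intDeriv L F) ζ).Infinitesimal) {x : Euc n} (hx : x ∈ U) :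
    Tendsto (fun p : ℕ × Euc n => pderivMulti L (Fs p.1) p.2)
      ((hyperfilter ℕ : Filter ℕ) ×ˢ 𝓝 x) (𝓝 (iapp (intDeriv L F) (starPt x)).st) := by
  subst hF
  have hxx : NearStd U (starPt x) :=
    ⟨x, hx, infinitesimal_germNorm_sub.2 (by simp)⟩
  refine tendsto_hyperfilter_prod_nhds_of_seq (G := fun i => pderivMulti L (Fs i))
    fun y hy => ?_
  have hyx : (germNorm ((y : NS (Euc n)) - starPt x)).Infinitesimal :=
    infinitesimal_germNorm_sub.2 (tendsto_sub_nhds_zero_iff.2 hy)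
  have h0 : Tendsto (fun i => pderivMulti L (Fs i) (y i) - pderivMulti L (Fs i) x)
      (hyperfilter ℕ : Filter ℕ) (𝓝 0) :=
    Hyperreal.isSt_ofSeq_iff_tendsto.1 (hS y (starPt x) ⟨x, hx, hyx⟩ hxx hyx)
  have h1 : Tendsto (fun i => pderivMulti L (Fs i) x) (hyperfilter ℕ : Filter ℕ)
      (𝓝 (iapp (intDeriv L (Fs : IntFun n)) (starPt x)).st) :=
    Hyperreal.tendsto_st_of_HFin (hfin _ hxx)
  simpa using h0.add h1

/-- If all derivatives of order `≤ k` converge continuously, the limits are differentiable up to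
order `k - 1`, with the expected derivatives. -/
theorem hasFDerivAt_of_tendsto_pderivMulti {ι : Type*} {l : Filter ι} [l.NeBot]
    {f : ι → Euc n → ℝ} {g : List (Fin n) → Euc n → ℝ} (hU : IsOpen U)
    (hf : ∀ i, ContDiffOn ℝ k (f i) U)
    (hg : ∀ L : List (Fin n), L.length ≤ k → ∀ x ∈ U,
      Tendsto (fun p : ι × Euc n => pderivMulti L (f p.1) p.2) (l ×ˢ 𝓝 x) (𝓝 (g L x)))
    {L : List (Fin n)} (hL : L.length < k) {x : Euc n} (hx : x ∈ U) :
    HasFDerivAt (g L) (∑ j, g (j :: L) x • (EuclideanSpace.proj j : Euc n →L[ℝ] ℝ)) x := by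
  have hpt : ∀ L : List (Fin n), L.length ≤ k → ∀ y ∈ U,
      Tendsto (fun i => pderivMulti L (f i) y) l (𝓝 (g L y)) := fun L hL y hy =>
    (hg L hL y hy).comp (tendsto_id.prodMk (tendsto_const_nhds (x := y)))
  have hcont : ∀ j, ContinuousAt (g (j :: L)) x := fun j =>
    continuousAt_of_tendsto_prod_nhds (hg (j :: L) hL x hx)
      ((hU.eventually_mem hx).mono (hpt (j :: L) hL))
  refine hasFDerivAt_of_tendstoUniformlyOnFilter (l := l)
    (f := fun i => pderivMulti L (f i))
    (f' := fun i y => ∑ j, pderivMulti (j :: L) (f i) y •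
      (EuclideanSpace.proj j : Euc n →L[ℝ] ℝ))
    (g' := fun y => ∑ j, g (j :: L) y • (EuclideanSpace.proj j : Euc n →L[ℝ] ℝ)) ?_ ?_
    ((hU.eventually_mem hx).mono (hpt L hL.le))
  · rw [tendstoUniformlyOnFilter_iff_tendsto]
    refine (Tendsto.prodMk_nhds ?_ ?_).mono_right (nhds_le_uniformity
      (∑ j, g (j :: L) x • (EuclideanSpace.proj j : Euc n →L[ℝ] ℝ)))
    · exact tendsto_finsetSum _ fun j _ => ((hcont j).tendsto.comp tendsto_snd).smul_const _
    · exact tendsto_finsetSum _ fun j _ => (hg (j :: L) hL x hx).smul_const _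
  · filter_upwards [(hU.eventually_mem hx).prod_inr l] with p hp
    have hC : ContDiffOn ℝ (1 : ℕ) (pderivMulti L (f p.1)) U :=
      contDiffOn_pderivMulti hU L 1 ((hf p.1).of_le (by exact_mod_cast hL))
    have hd := ((hC.differentiableOn (by simp)).differentiableAt (hU.mem_nhds hp)).hasFDerivAt
    rwa [fderiv_eq_sum_pderivCoord] at hd

theorem contDiffOn_of_hasFDerivAt_sum {g : List (Fin n) → Euc n → ℝ}
    (hcont : ∀ L : List (Fin n), L.length ≤ k → ContinuousOn (g L) U)
    (hderiv : ∀ L : List (Fin n), L.length < k → ∀ x ∈ U,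
      HasFDerivAt (g L) (∑ j, g (j :: L) x • (EuclideanSpace.proj j : Euc n →L[ℝ] ℝ)) x)
    (hU : IsOpen U) (m : ℕ) :
    ∀ L : List (Fin n), L.length + m ≤ k → ContDiffOn ℝ m (g L) U := by
  induction m with
  | zero => exact fun L hL => contDiffOn_zero.2 (hcont L hL)
  | succ m ih =>
    intro L hL
    have hLk : L.length < k := by omega
    rw [Nat.cast_succ, contDiffOn_succ_iff_fderiv_of_isOpen hU]
    refine ⟨fun x hx => (hderiv L hLk x hx).differentiableAt.differentiableWithinAt,
      fun h => absurd h (by simp), ?_⟩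
    refine ContDiffOn.congr (ContDiffOn.sum fun j _ => (ih (j :: L) ?_).smul contDiffOn_const)
      fun x hx => (hderiv L hLk x hx).fderiv
    rw [List.length_cons]
    omega

theorem pderivMulti_eqOn_of_hasFDerivAt_sum {g : List (Fin n) → Euc n → ℝ}
    (hderiv : ∀ L : List (Fin n), L.length < k → ∀ x ∈ U,
      HasFDerivAt (g L) (∑ j, g (j :: L) x • (EuclideanSpace.proj j : Euc n →L[ℝ] ℝ)) x)
    (hU : IsOpen U) :
    ∀ L : List (Fin n), L.length ≤ k → Set.EqOn (pderivMulti L (g [])) (g L) U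
  | [], _ => fun _ _ => rfl
  | i :: L, hL => fun x hx => by
    have ih := pderivMulti_eqOn_of_hasFDerivAt_sum hderiv hU L (Nat.le_of_succ_le hL)
    rw [pderivMulti, pderivCoord, (ih.eventuallyEq_of_mem (hU.mem_nhds hx)).fderiv_eq,
      (hderiv L hL x hx).fderiv]
    simp

end StandardPart

/-- The standard part of an `SC^k` internal function is `C^k`, and
taking standard parts commutes with all partial derivatives of order `≤ k`. -/
theorem stmt13 {n : ℕ} (k : ℕ) (U : Set (Euc n)) (hU : IsOpen U)
    (F : IntFun n) (hF : SCk k U F) :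
    ContDiffOn ℝ k (stdPart F) U ∧
    ∀ L : List (Fin n), L.length ≤ k → ∀ x ∈ U,
      pderivMulti L (stdPart F) x = (iapp (intDeriv L F) (starPt x)).st := by
  obtain ⟨Fs, hFs, hC, hS⟩ := hF
  let g : List (Fin n) → Euc n → ℝ := fun L x => (iapp (intDeriv L F) (starPt x)).st
  have hg : ∀ L : List (Fin n), L.length ≤ k → ∀ x ∈ U,
      Tendsto (fun p : ℕ × Euc n => pderivMulti L (Fs p.1) p.2)
        ((hyperfilter ℕ : Filter ℕ) ×ˢ 𝓝 x) (𝓝 (g L x)) := fun L hL x hx =>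
    tendsto_pderivMulti_prod_nhds hFs (hS L hL).1 (hS L hL).2 hx
  have hcont : ∀ L : List (Fin n), L.length ≤ k → ContinuousOn (g L) U := fun L hL x hx =>
    (continuousAt_of_tendsto_prod_nhds (hg L hL x hx) <| (hU.eventually_mem hx).mono fun y hy =>
      (hg L hL y hy).comp (tendsto_id.prodMk (tendsto_const_nhds (x := y)))).continuousWithinAt
  have hderiv : ∀ L : List (Fin n), L.length < k → ∀ x ∈ U,
      HasFDerivAt (g L) (∑ j, g (j :: L) x • (EuclideanSpace.proj j : Euc n →L[ℝ] ℝ)) x :=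
    fun L hL x hx => hasFDerivAt_of_tendsto_pderivMulti hU hC hg hL hx
  have hnil : stdPart F = g [] := by
    subst hFs
    rfl
  rw [hnil]
  exact ⟨contDiffOn_of_hasFDerivAt_sum hcont hderiv hU k [] (by simp),
    pderivMulti_eqOn_of_hasFDerivAt_sum hderiv hU⟩
end

section
/- Let k ∈ ℕ, let U ⊆ ℝⁿ be open, and let 𝔉 and 𝔊 be internal functions of class SC^k on U such that 𝔉(ξ) ≈ 𝔊(ξ) for every ξ ∈ *ℝⁿ nearstandard in U. Then for every multi-index α with |α| ≤ k and every ξ nearstandard in U one has (∂^α𝔉)(ξ) ≈ (∂^α𝔊)(ξ): pointwise infinitesimal closeness of SC^k internal functions forces infinitesimal closeness of all internal derivatives up to order k. -/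
open Filter Topology

/-- Countable saturation of the ultrapower: properties that each hold almost everywhere hold
simultaneously at some infinite index. -/
theorem exists_tendsto_atTop_eventually_diagonal {P : ℕ → ℕ → Prop}
    (h : ∀ j, ∀ᶠ m in (hyperfilter ℕ : Filter ℕ), P j m) :
    ∃ N : ℕ → ℕ, Tendsto N (hyperfilter ℕ : Filter ℕ) atTop ∧
      ∀ᶠ m in (hyperfilter ℕ : Filter ℕ), P (N m) m := by
  classical
  refine ⟨fun m => Nat.findGreatest (fun j => P j m) m, ?_, ?_⟩
  · refine tendsto_atTop.2 fun j => ?_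
    filter_upwards [h j, Nat.hyperfilter_le_atTop (eventually_ge_atTop j)] with m hm hjm
    exact Nat.le_findGreatest hjm hm
  · filter_upwards [h 0] with m hm
    exact Nat.findGreatest_spec (P := fun j => P j m) (Nat.zero_le m) hm

theorem infinitesimal_coe_iff {u : ℕ → ℝ} :
    Hyperreal.Infinitesimal (↑u : Germ (hyperfilter ℕ : Filter ℕ) ℝ) ↔
      Tendsto u (hyperfilter ℕ : Filter ℕ) (𝓝 0) :=
  Hyperreal.isSt_ofSeq_iff_tendsto

theorem infClose_coe_iff {n : ℕ} {ξ ζ : ℕ → Euc n} :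
    InfClose (↑ξ : NS (Euc n)) (↑ζ : NS (Euc n)) ↔
      Tendsto (fun m => ξ m - ζ m) (hyperfilter ℕ : Filter ℕ) (𝓝 0) :=
  infinitesimal_coe_iff.trans tendsto_zero_iff_norm_tendsto_zero.symm

theorem nearStd_coe_iff {n : ℕ} {U : Set (Euc n)} {ξ : ℕ → Euc n} :
    NearStd U (↑ξ : NS (Euc n)) ↔
      ∃ x ∈ U, Tendsto ξ (hyperfilter ℕ : Filter ℕ) (𝓝 x) := by
  refine exists_congr fun x => and_congr_right fun _ => ?_
  rw [← tendsto_sub_nhds_zero_iff]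
  exact infClose_coe_iff (ζ := fun _ => x)

theorem infinitesimal_iapp_sub_iff {n : ℕ} {f g : ℕ → Euc n → ℝ} {ξ ζ : ℕ → Euc n} :
    (iapp (↑f : IntFun n) (↑ξ : NS (Euc n)) -
        iapp (↑g : IntFun n) (↑ζ : NS (Euc n))).Infinitesimal ↔
      Tendsto (fun m => f m (ξ m) - g m (ζ m)) (hyperfilter ℕ : Filter ℕ) (𝓝 0) :=
  infinitesimal_coe_iff

theorem ContDiffOn.pderivMulti {n : ℕ} {U : Set (Euc n)} (hU : IsOpen U) {f : Euc n → ℝ} {k : ℕ}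
    (hf : ContDiffOn ℝ k f U) (L : List (Fin n)) {j : ℕ} (hj : L.length + j ≤ k) :
    ContDiffOn ℝ j (pderivMulti L f) U := by
  induction L generalizing j with
  | nil => exact hf.of_le (by simpa using hj)
  | cons i L ih =>
    have h := ih (j := j + 1) (by simp at hj; omega)
    exact (h.fderiv_of_isOpen hU (m := (j : WithTop ℕ∞)) (by simp)).clm_apply contDiffOn_const

/-- If internal functions are infinitesimal at nearstandard points, then each partial derivative is
infinitesimal at some point infinitely close to a given one. -/
theorem exists_tendsto_pderivCoord_zero {n : ℕ} {U : Set (Euc n)} (hU : IsOpen U)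
    {h : ℕ → Euc n → ℝ} (hd : ∀ m, DifferentiableOn ℝ (h m) U)
    (h0 : ∀ (η : ℕ → Euc n) (y : Euc n), y ∈ U → Tendsto η (hyperfilter ℕ : Filter ℕ) (𝓝 y) →
      Tendsto (fun m => h m (η m)) (hyperfilter ℕ : Filter ℕ) (𝓝 0))
    (i : Fin n) {ξ : ℕ → Euc n} {x : Euc n} (hx : x ∈ U)
    (hξ : Tendsto ξ (hyperfilter ℕ : Filter ℕ) (𝓝 x)) :
    ∃ ζ : ℕ → Euc n, Tendsto (fun m => ζ m - ξ m) (hyperfilter ℕ : Filter ℕ) (𝓝 0) ∧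
      Tendsto (fun m => pderivCoord i (h m) (ζ m)) (hyperfilter ℕ : Filter ℕ) (𝓝 0) := by
  obtain ⟨r, hr, hrU⟩ := Metric.isOpen_iff.1 hU x hx
  obtain ⟨n₀, hn₀⟩ := exists_nat_one_div_lt (half_pos hr)
  set e : Euc n := EuclideanSpace.single i (1 : ℝ) with he
  have he1 : ‖e‖ = 1 := by simp [he]
  set t : ℕ → ℝ := fun j => 1 / (((j + n₀ : ℕ) : ℝ) + 1) with ht
  have htpos : ∀ j, 0 < t j := fun j => Nat.one_div_pos_of_nat
  have htr : ∀ j, t j < r / 2 := fun j =>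
    (Nat.one_div_le_one_div (Nat.le_add_left n₀ j)).trans_lt hn₀
  have ht0 : Tendsto t atTop (𝓝 0) :=
    tendsto_one_div_add_atTop_nhds_zero_nat.comp (tendsto_add_atTop_nat n₀)
  have hnorm : ∀ j, ‖t j • e‖ = t j := fun j => by
    rw [norm_smul, he1, mul_one, Real.norm_of_nonneg (htpos j).le]
  have hP : ∀ j, ∀ᶠ m in (hyperfilter ℕ : Filter ℕ),
      |h m (ξ m + t j • e) - h m (ξ m)| ≤ t j * t j := fun j => by
    have hmem : x + t j • e ∈ U := hrU <| by
      rw [Metric.mem_ball, dist_eq_norm, add_sub_cancel_left, hnorm]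
      linarith [htr j]
    have hlim := (h0 _ _ hmem (hξ.add_const (t j • e))).sub (h0 _ _ hx hξ)
    rw [sub_zero] at hlim
    have := hlim.abs
    rw [abs_zero] at this
    exact this.eventually_le_const (mul_pos (htpos j) (htpos j))
  obtain ⟨N, hN, hPN⟩ := exists_tendsto_atTop_eventually_diagonal hP
  have htN : Tendsto (fun m => t (N m)) (hyperfilter ℕ : Filter ℕ) (𝓝 0) := ht0.comp hN
  have hball : ∀ᶠ m in (hyperfilter ℕ : Filter ℕ), ξ m ∈ Metric.ball x (r / 2) :=
    hξ (Metric.ball_mem_nhds x (half_pos hr))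
  have hex : ∀ᶠ m in (hyperfilter ℕ : Filter ℕ), ∃ z : Euc n,
      ‖z - ξ m‖ ≤ t (N m) ∧ ‖pderivCoord i (h m) z‖ ≤ t (N m) := by
    filter_upwards [hPN, hball] with m hm hb
    set τ := t (N m)
    have hτ : 0 < τ := htpos _
    have hb1 : ξ m ∈ Metric.ball x r := Metric.ball_subset_ball (by linarith) hb
    have hb2 : ξ m + τ • e ∈ Metric.ball x r := by
      rw [Metric.mem_ball, dist_eq_norm] at hb ⊢
      have := norm_add_le (ξ m - x) (τ • e)
      rw [hnorm, sub_add_eq_add_sub] at this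
      linarith [htr (N m)]
    obtain ⟨z, hz, hzeq⟩ := domain_mvt (f := h m) (f' := fderiv ℝ (h m)) (s := Metric.ball x r)
      (fun y hy => (((hd m).differentiableAt (hU.mem_nhds (hrU hy))).hasFDerivAt).hasFDerivWithinAt)
      (convex_ball x r) hb1 hb2
    refine ⟨z, ?_, ?_⟩
    · have := norm_sub_le_of_mem_segment hz
      rwa [add_sub_cancel_left, hnorm] at this
    · rw [add_sub_cancel_left, map_smul, smul_eq_mul] at hzeq
      rw [hzeq, abs_mul, abs_of_pos hτ] at hm
      exact le_of_mul_le_mul_left hm hτ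
  obtain ⟨ζ, hζ⟩ := hex.choice
  exact ⟨ζ, squeeze_zero_norm' (hζ.mono fun _ hm => hm.1) htN,
    squeeze_zero_norm' (hζ.mono fun _ hm => hm.2) htN⟩


/-- Pointwise infinitesimal closeness of `SC^k` internal functions at
nearstandard points forces infinitesimal closeness of all internal derivatives of order
`≤ k`. -/
theorem stmt14 {n : ℕ} (k : ℕ) (U : Set (Euc n)) (hU : IsOpen U)
    (F G : IntFun n) (hF : SCk k U F) (hG : SCk k U G)
    (hclose : ∀ ξ : NS (Euc n), NearStd U ξ → (iapp F ξ - iapp G ξ).Infinitesimal) :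
    ∀ L : List (Fin n), L.length ≤ k → ∀ ξ : NS (Euc n), NearStd U ξ →
      (iapp (intDeriv L F) ξ - iapp (intDeriv L G) ξ).Infinitesimal := by
  obtain ⟨Fs, rfl, hFd, hFS⟩ := hF
  obtain ⟨Gs, rfl, hGd, hGS⟩ := hG
  intro L
  induction L with
  | nil => exact fun _ => hclose
  | cons i L ih =>
    intro hL ξ
    have hL' : L.length + 1 ≤ k := hL
    refine Germ.inductionOn ξ fun ξ hξ => ?_
    obtain ⟨x, hx, hξx⟩ := nearStd_coe_iff.1 hξ
    have hFdiff : ∀ m, DifferentiableOn ℝ (pderivMulti L (Fs m)) U := fun m =>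
      ((hFd m).pderivMulti hU L (j := 1) hL').differentiableOn (by simp)
    have hGdiff : ∀ m, DifferentiableOn ℝ (pderivMulti L (Gs m)) U := fun m =>
      ((hGd m).pderivMulti hU L (j := 1) hL').differentiableOn (by simp)
    obtain ⟨ζ, hζξ, hζ⟩ := exists_tendsto_pderivCoord_zero hU
      (h := fun m => pderivMulti L (Fs m) - pderivMulti L (Gs m))
      (fun m => (hFdiff m).sub (hGdiff m))
      (fun η y hy hη => infinitesimal_iapp_sub_iff.1
        (ih (by omega) (↑η) (nearStd_coe_iff.2 ⟨y, hy, hη⟩))) i hx hξx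
    have hζx : Tendsto ζ (hyperfilter ℕ : Filter ℕ) (𝓝 x) := by
      simpa using hζξ.add hξx
    have hζn : NearStd U (↑ζ : NS (Euc n)) := nearStd_coe_iff.2 ⟨x, hx, hζx⟩
    have hcl : InfClose (↑ζ : NS (Euc n)) ↑ξ := infClose_coe_iff.2 hζξ
    have hF' := infinitesimal_iapp_sub_iff.1 ((hFS (i :: L) hL).2 _ _ hζn hξ hcl)
    have hG' := infinitesimal_iapp_sub_iff.1 ((hGS (i :: L) hL).2 _ _ hζn hξ hcl)
    have hlim := (hζ.sub hF').add hG'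
    rw [sub_zero, add_zero] at hlim
    refine infinitesimal_iapp_sub_iff.2 (hlim.congr' ?_)
    filter_upwards [hζx (hU.mem_nhds hx)] with m hm
    have hs : pderivCoord i (pderivMulti L (Fs m) - pderivMulti L (Gs m)) (ζ m) =
        pderivMulti (i :: L) (Fs m) (ζ m) - pderivMulti (i :: L) (Gs m) (ζ m) := by
      simp only [pderivMulti, pderivCoord]
      rw [fderiv_sub ((hFdiff m).differentiableAt (hU.mem_nhds hm))
        ((hGdiff m).differentiableAt (hU.mem_nhds hm))]
      rfl
    simp only [Function.comp_apply]
    rw [hs]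
    ring
end

section
/- Let U ⊆ ℝⁿ be open and connected and let 𝔉 be an internal function on ℝⁿ such that: (a) |𝔉(ξ) − 𝔉(ζ)| is infinitesimal whenever ξ and ζ are nearstandard in U with ξ ≈ ζ; and (b) there exists a point ξ₀ nearstandard in U with 𝔉(ξ₀) finite. Then 𝔉(ξ) is finite for every ξ nearstandard in U; consequently 𝔉 is S-continuous on the nearstandard points of U. -/
open Filter Topology

set_option linter.deprecated false

/-- Countable saturation of the hyperfilter, for conditions along a countably generated filter. -/
theorem exists_tendsto_hyperfilter {β : Type*} {l : Filter β} [l.IsCountablyGenerated]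
    {p : ℕ → β → Prop} (h : ∀ s ∈ l, ∀ᶠ i in hyperfilter ℕ, ∃ y ∈ s, p i y) :
    ∃ y : ℕ → β, Tendsto y (hyperfilter ℕ) l ∧ ∀ᶠ i in hyperfilter ℕ, p i (y i) := by
  classical
  obtain ⟨s, hs⟩ := l.exists_antitone_basis
  have hS (k : ℕ) : ∀ᶠ i in hyperfilter ℕ, ∃ y ∈ s k, p i y := h _ (hs.mem k)
  obtain ⟨_, y₀, -, -⟩ := (hS 0).exists
  let K (i : ℕ) : ℕ := Nat.findGreatest (fun k => ∃ y ∈ s k, p i y) i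
  have hK (i k : ℕ) (hki : k ≤ i) (hk : ∃ y ∈ s k, p i y) : ∃ y ∈ s (K i), p i y :=
    Nat.findGreatest_spec (P := fun k => ∃ y ∈ s k, p i y) hki hk
  have hy (i : ℕ) : ∃ y, (∃ z ∈ s (K i), p i z) → y ∈ s (K i) ∧ p i y := by
    by_cases hz : ∃ z ∈ s (K i), p i z
    · obtain ⟨z, hz⟩ := hz
      exact ⟨z, fun _ => hz⟩
    · exact ⟨y₀, fun h => absurd h hz⟩
  choose y hy using hy
  refine ⟨y, hs.tendsto_right_iff.2 fun k _ => ?_, ?_⟩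
  · filter_upwards [hS k, Nat.hyperfilter_le_atTop (eventually_ge_atTop k)] with i hi hki
    exact hs.antitone (Nat.le_findGreatest hki hi) (hy i (hK i k hki hi)).1
  · filter_upwards [hS 0] with i hi
    exact (hy i (hK i 0 i.zero_le hi)).2

theorem infinitesimal_ofSeq_iff_tendsto {f : ℕ → ℝ} :
    (Hyperreal.ofSeq f).Infinitesimal ↔ Tendsto f (hyperfilter ℕ) (𝓝 0) :=
  Hyperreal.isSt_ofSeq_iff_tendsto

theorem germNorm_sub_starPt_infinitesimal_iff {E : Type*} [NormedAddCommGroup E]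
    {y : ℕ → E} {x : E} :
    (germNorm ((y : NS E) - starPt x)).Infinitesimal ↔ Tendsto y (hyperfilter ℕ) (𝓝 x) :=
  infinitesimal_ofSeq_iff_tendsto.trans tendsto_iff_norm_sub_tendsto_zero.symm

theorem nearStd_starPt {n : ℕ} {U : Set (Euc n)} {x : Euc n} (hx : x ∈ U) :
    NearStd U (starPt x) :=
  ⟨x, hx, germNorm_sub_starPt_infinitesimal_iff.2 tendsto_const_nhds⟩

theorem HFin.add {a b : Hyperreal} (ha : HFin a) (hb : HFin b) : HFin (a + b) := by
  obtain ⟨r, hr⟩ := ha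
  obtain ⟨s, hs⟩ := hb
  exact ⟨r + s, (abs_add_le a b).trans (by simpa using add_le_add hr hs)⟩

theorem hFin_iff_of_hFin_sub {a b : Hyperreal} (h : HFin (a - b)) : HFin a ↔ HFin b := by
  refine ⟨fun ha => ?_, fun hb => by simpa using h.add hb⟩
  have h' : HFin (b - a) := by
    obtain ⟨r, hr⟩ := h
    exact ⟨r, abs_sub_comm a b ▸ hr⟩
  simpa using h'.add ha

theorem hFin_of_infinitesimal {a : Hyperreal} (h : a.Infinitesimal) : HFin a := by
  have := Hyperreal.abs_lt_real_iff_infinitesimal.1 h 1 one_ne_zero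
  exact ⟨1, by simpa using this.le⟩

/-- Overspill: an internal function with infinitesimal increments at a standard point `x` has
finite increments at all standard points of some neighbourhood of `x`. -/
theorem eventually_hFin_sub {n : ℕ} {U : Set (Euc n)} {F : IntFun n}
    (ha : ∀ ξ ζ : NS (Euc n), NearStd U ξ → NearStd U ζ → InfClose ξ ζ →
      (iapp F ξ - iapp F ζ).Infinitesimal) {x : Euc n} (hx : x ∈ U) :
    ∀ᶠ y in 𝓝 x, HFin (iapp F (starPt y) - iapp F (starPt x)) := by
  induction F using Filter.Germ.inductionOn with | _ f => ?_
  by_contra hcon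
  obtain ⟨y, hyx, hy⟩ := exists_tendsto_hyperfilter (l := 𝓝 x)
      (p := fun i y => 1 < |f i y - f i x|) fun s hs => by
    by_contra hs'
    have hs' : ∀ᶠ i in hyperfilter ℕ, ¬ ∃ y ∈ s, 1 < |f i y - f i x| :=
      Ultrafilter.eventually_not.2 hs'
    refine hcon (mem_of_superset hs fun y hys => ⟨1, ?_⟩)
    have hle : ∀ᶠ i in hyperfilter ℕ, |f i y - f i x| ≤ 1 :=
      hs'.mono fun i hi => not_lt.1 fun hlt => hi ⟨y, hys, hlt⟩
    exact (Germ.abs_def _).trans_le (Hyperreal.ofSeq_le_ofSeq.2 hle)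
  have hyx' : (germNorm ((y : NS (Euc n)) - starPt x)).Infinitesimal :=
    germNorm_sub_starPt_infinitesimal_iff.2 hyx
  have hlim : Tendsto (fun i => f i (y i) - f i x) (hyperfilter ℕ) (𝓝 0) :=
    infinitesimal_ofSeq_iff_tendsto.1 (ha y (starPt x) ⟨x, hx, hyx'⟩ (nearStd_starPt hx) hyx')
  have habs : ∀ᶠ i in hyperfilter ℕ, |f i (y i) - f i x| < 1 :=
    hlim.abs.eventually_lt_const (by simp)
  obtain ⟨i, hi, hi'⟩ := (hy.and habs).exists
  exact lt_asymm hi hi'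

/-- An internal function satisfying the S-continuity increment condition
on the nearstandard points of a connected open set, and finite at one nearstandard point,
is finite at all nearstandard points (hence S-continuous there). -/
theorem stmt17 {n : ℕ} (U : Set (Euc n)) (hU : IsOpen U) (hconn : IsConnected U)
    (F : IntFun n)
    (ha : ∀ ξ ζ : NS (Euc n), NearStd U ξ → NearStd U ζ → InfClose ξ ζ →
      (iapp F ξ - iapp F ζ).Infinitesimal)
    (ξ₀ : NS (Euc n)) (hξ₀ : NearStd U ξ₀) (hfin : HFin (iapp F ξ₀)) :
    (∀ ξ : NS (Euc n), NearStd U ξ → HFin (iapp F ξ)) ∧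
    (∀ ξ ζ : NS (Euc n), NearStd U ξ → NearStd U ζ → InfClose ξ ζ →
      (iapp F ξ - iapp F ζ).Infinitesimal) := by
  have hstar {ξ : NS (Euc n)} {x : Euc n} (hx : x ∈ U)
      (hξ : (germNorm (ξ - starPt x)).Infinitesimal) :
      HFin (iapp F ξ) ↔ HFin (iapp F (starPt x)) :=
    hFin_iff_of_hFin_sub
      (hFin_of_infinitesimal (ha ξ (starPt x) ⟨x, hx, hξ⟩ (nearStd_starPt hx) hξ))
  refine ⟨fun ξ ⟨x, hx, hξ⟩ => ?_, ha⟩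
  obtain ⟨x₀, hx₀, hξ₀⟩ := hξ₀
  have hconst : HFin (iapp F (starPt x₀)) ↔ HFin (iapp F (starPt x)) :=
    hconn.isPreconnected.induction₂
      (fun y z => HFin (iapp F (starPt y)) ↔ HFin (iapp F (starPt z)))
      (fun y hy => mem_nhdsWithin_of_mem_nhds <|
        (eventually_hFin_sub ha hy).mono fun z hz => (hFin_iff_of_hFin_sub hz).symm)
      (fun _ _ _ _ _ _ => Iff.trans) (fun _ _ _ _ => Iff.symm) hx₀ hx
  exact (hstar hx hξ).2 (hconst.1 ((hstar hx₀ hξ₀).1 hfin))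
end
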